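/- If G is a planar graph with girth at least 7 and maximum degree Δ ≥ 6, then the 2-distance list chromatic number of G is at most Δ + 3. -/

import Mathlib

open SimpleGraph

/-- Two distinct vertices are at distance at most 2. -/
def TwoDistAdj {V : Type} (G : SimpleGraph V) (u v : V) : Prop :=
  u ≠ v ∧ (G.Adj u v ∨ ∃ w, G.Adj u w ∧ G.Adj w v)

/-- `φ` is a 2-distance coloring of `G` from the lists `L`. -/
def IsTwoDistListColoring {V : Type} (G : SimpleGraph V) (L : V → Finset ℕ) (φ : V → ℕ) :
    Prop :=
  (∀ v, φ v ∈ L v) ∧ ∀ u v, TwoDistAdj G u v → φ u ≠ φ v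

/-- A finite simple graph is planar iff it admits a straight-line plane embedding
(equivalent to topological planarity by Fáry's theorem). -/
def IsPlanar {V : Type} (G : SimpleGraph V) : Prop :=
  ∃ f : V → ℝ × ℝ, Function.Injective f ∧
    (∀ ⦃u v w⦄, G.Adj u v → f w ∈ segment ℝ (f u) (f v) → w = u ∨ w = v) ∧
    (∀ ⦃u v x y⦄, G.Adj u v → G.Adj x y → s(u, v) ≠ s(x, y) →
      segment ℝ (f u) (f v) ∩ segment ℝ (f x) (f y) ⊆ f '' ({u, v} ∩ {x, y}))


/-! ### Part 1: an Euler-type bound for straight-line drawings -/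

section Planar

variable {V : Type}

/-- slope of an oriented edge -/
noncomputable def slp (X Y : V → ℝ) (e : V × V) : ℝ := (Y e.2 - Y e.1) / (X e.2 - X e.1)

/-- height of the line through an oriented edge at abscissa `t` -/
noncomputable def hgt (X Y : V → ℝ) (e : V × V) (t : ℝ) : ℝ := Y e.1 + (t - X e.1) * slp X Y e

/-- A generic straight-line drawing. -/
structure Drawn (G : SimpleGraph V) (X Y : V → ℝ) : Prop where
  inj : Function.Injective X
  on_edge : ∀ a b w, G.Adj a b → X a < X w → X w < X b → hgt X Y (a, b) (X w) ≠ Y w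
  cross : ∀ a b u v t, G.Adj a b → G.Adj u v → X a < t → t < X b → X u < t → t < X v →
    (a, b) ≠ (u, v) → hgt X Y (a, b) t ≠ hgt X Y (u, v) t

lemma Drawn.mono {G H : SimpleGraph V} {X Y : V → ℝ} (h : Drawn G X Y) (hle : H ≤ G) :
    Drawn H X Y :=
  ⟨h.inj, fun a b w hab => h.on_edge a b w (hle hab),
    fun a b u v t hab huv => h.cross a b u v t (hle hab) (hle huv)⟩

lemma hgt_snd (X Y : V → ℝ) (e : V × V) (t : ℝ) (h : X e.1 < X e.2) :
    hgt X Y e t = Y e.2 + (t - X e.2) * slp X Y e := by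
  have : X e.2 - X e.1 ≠ 0 := by linarith [sub_pos.2 h]
  unfold hgt slp
  field_simp
  ring

lemma exists_drawn [Fintype V] (G : SimpleGraph V) (hp : IsPlanar G) :
    ∃ X Y : V → ℝ, Drawn G X Y := by
  classical
  obtain ⟨f, hf, h1, h2⟩ := hp
  let bad : Finset ℝ := (Finset.univ : Finset (V × V)).image
    (fun p => -((f p.1).1 - (f p.2).1) / ((f p.1).2 - (f p.2).2))
  obtain ⟨c, hc⟩ := Infinite.exists_notMem_finset bad
  have hinj : Function.Injective (fun v => (f v).1 + c * (f v).2) := by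
    intro u v huv
    by_contra hne
    have hfne : f u ≠ f v := fun h => hne (hf h)
    simp only at huv
    by_cases hy : (f u).2 = (f v).2
    · apply hfne
      rw [hy] at huv
      exact Prod.ext (by linarith) hy
    · apply hc
      refine Finset.mem_image.2 ⟨(u, v), Finset.mem_univ _, ?_⟩
      have : (f u).2 - (f v).2 ≠ 0 := sub_ne_zero.2 hy
      simp only
      field_simp
      linarith
  set X : V → ℝ := fun v => (f v).1 + c * (f v).2 with hX
  set Y : V → ℝ := fun v => (f v).2 with hY
  -- point on the segment
  have seg : ∀ a b t, X a < t → t < X b →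
      ((t - c * hgt X Y (a, b) t, hgt X Y (a, b) t) : ℝ × ℝ) ∈ segment ℝ (f a) (f b) := by
    intro a b t ha hb
    have hd : 0 < X b - X a := by linarith
    refine ⟨(X b - t) / (X b - X a), (t - X a) / (X b - X a), by
      apply div_nonneg <;> linarith, by apply div_nonneg <;> linarith, ?_, ?_⟩
    · field_simp; ring
    · have hyy : (X b - t) / (X b - X a) * Y a + (t - X a) / (X b - X a) * Y b
          = hgt X Y (a, b) t := by
        unfold hgt slp; simp only; field_simp; ring
      have hxx : (X b - t) / (X b - X a) * X a + (t - X a) / (X b - X a) * X b = t := by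
        field_simp; ring
      have e1 : ∀ v, (f v).1 = X v - c * Y v := fun v => by simp [hX, hY]
      refine Prod.ext ?_ ?_
      · simp only [Prod.fst_add, Prod.smul_fst, smul_eq_mul, e1]
        rw [← hyy]
        linear_combination hxx
      · simpa using hyy
  refine ⟨X, Y, hinj, ?_, ?_⟩
  · intro a b w hab ha hb heq
    have hs := seg a b (X w) ha hb
    rw [heq] at hs
    have : ((X w - c * Y w, Y w) : ℝ × ℝ) = f w := by
      refine Prod.ext ?_ ?_ <;> simp [hX, hY]
    rw [this] at hs
    rcases h1 hab hs with rfl | rfl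
    · exact lt_irrefl _ ha
    · exact lt_irrefl _ hb
  · intro a b u v t hab huv ha hb hu hv hne heq
    have hs := seg a b t ha hb
    have hs' := seg u v t hu hv
    rw [← heq] at hs'
    have hne' : s(a, b) ≠ s(u, v) := by
      intro h
      rcases Sym2.eq_iff.1 h with ⟨rfl, rfl⟩ | ⟨rfl, rfl⟩
      · exact hne rfl
      · linarith
    obtain ⟨w, ⟨hw, -⟩, hfw⟩ := h2 hab huv hne' ⟨hs, hs'⟩
    have : X w = t := by
      simp [hX, hfw]
    rcases hw with rfl | rfl
    · linarith
    · linarith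

/-- Sign of the difference is preserved inside the overlap. -/
lemma Drawn.sign {G : SimpleGraph V} {X Y : V → ℝ} (h : Drawn G X Y) {a b u v : V}
    (hab : G.Adj a b) (huv : G.Adj u v) (hne : (a, b) ≠ (u, v)) {t m : ℝ}
    (t1 : X a ≤ t) (t2 : t ≤ X b) (t3 : X u ≤ t) (t4 : t ≤ X v)
    (m1 : X a < m) (m2 : m < X b) (m3 : X u < m) (m4 : m < X v)
    (ht : hgt X Y (u, v) t < hgt X Y (a, b) t) : hgt X Y (u, v) m < hgt X Y (a, b) m := by
  by_contra hcon
  push Not at hcon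
  have hlt : hgt X Y (a, b) m < hgt X Y (u, v) m :=
    lt_of_le_of_ne hcon (h.cross a b u v m hab huv m1 m2 m3 m4 hne)
  -- zero of the affine difference
  set A := hgt X Y (a, b) t - hgt X Y (u, v) t with hA
  set B := hgt X Y (u, v) m - hgt X Y (a, b) m with hB
  have hApos : 0 < A := by linarith
  have hBpos : 0 < B := by linarith
  set s := (B * t + A * m) / (A + B) with hs
  have hAB : 0 < A + B := by linarith
  have hr : s * (A + B) = B * t + A * m := by rw [hs]; field_simp
  have lo : ∀ x : ℝ, x ≤ t → x < m → x < s := by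
    intro x h1 h2
    rw [hs, lt_div_iff₀ hAB]; nlinarith
  have hi : ∀ x : ℝ, t ≤ x → m < x → s < x := by
    intro x h1 h2
    rw [hs, div_lt_iff₀ hAB]; nlinarith
  apply h.cross a b u v s hab huv (lo _ t1 m1) (hi _ t2 m2) (lo _ t3 m3) (hi _ t4 m4) hne
  have : (A + B) * (hgt X Y (a, b) s - hgt X Y (u, v) s) = 0 := by
    unfold hgt at hA hB ⊢
    simp only at hA hB ⊢
    linear_combination (slp X Y (a, b) - slp X Y (u, v)) * hr - B * hA + A * hB
  have := (mul_eq_zero.1 this).resolve_left hAB.ne'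
  linarith

/-- left end indicator -/
def LInd (X Y : V → ℝ) (e g : V × V) : Prop :=
  (X g.1 < X e.1 ∧ X e.1 < X g.2 ∧ Y e.1 < hgt X Y g (X e.1))
def LInd' (X Y : V → ℝ) (e g : V × V) : Prop :=
  (g.1 = e.1 ∧ slp X Y e < slp X Y g)
def RInd (X Y : V → ℝ) (e g : V × V) : Prop :=
  (X g.1 < X e.2 ∧ X e.2 < X g.2 ∧ Y e.2 < hgt X Y g (X e.2))
def RInd' (X Y : V → ℝ) (e g : V × V) : Prop :=
  (g.2 = e.2 ∧ slp X Y g < slp X Y e)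
def TInd (X Y : V → ℝ) (e : V × V) (y : V) : Prop :=
  (X e.1 < X y ∧ X y < X e.2 ∧ hgt X Y e (X y) < Y y)

open Classical in
/-- indicator in `ZMod 2` -/
noncomputable def ind (P : Prop) : ZMod 2 := if P then 1 else 0

lemma ind_true {P : Prop} (h : P) : ind P = 1 := if_pos h
lemma ind_false {P : Prop} (h : ¬ P) : ind P = 0 := if_neg h

lemma Drawn.parity {G : SimpleGraph V} {X Y : V → ℝ} (h : Drawn G X Y) {e g : V × V}
    (he : G.Adj e.1 e.2) (hg : G.Adj g.1 g.2) (hex : X e.1 < X e.2) (hgx : X g.1 < X g.2) :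
    ind (LInd X Y e g) + ind (LInd' X Y e g) + ind (RInd X Y e g) + ind (RInd' X Y e g)
      + (ind (TInd X Y e g.1) + ind (TInd X Y e g.2)) = 0 := by
  obtain ⟨u, v⟩ := e
  obtain ⟨a, b⟩ := g
  simp only at he hg hex hgx
  by_cases hne : (a, b) = (u, v)
  · obtain ⟨rfl, rfl⟩ := Prod.mk.inj hne
    rw [ind_false, ind_false, ind_false, ind_false, ind_false, ind_false] <;>
      simp [LInd, LInd', RInd, RInd', TInd]
  by_cases hov : X b ≤ X u ∨ X v ≤ X a
  · rw [ind_false, ind_false, ind_false, ind_false, ind_false, ind_false]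
    · simp
    all_goals
      simp only [LInd, LInd', RInd, RInd', TInd]
      first
      | (rintro ⟨h1, h2, -⟩; rcases hov with h | h <;> linarith)
      | (rintro ⟨rfl, -⟩; rcases hov with h | h <;> linarith)
  push Not at hov
  obtain ⟨o1, o2⟩ := hov
  set m := (max (X a) (X u) + min (X b) (X v)) / 2 with hm
  have hlt : max (X a) (X u) < min (X b) (X v) := by
    rw [max_lt_iff, lt_min_iff, lt_min_iff]; exact ⟨⟨hgx, o2⟩, ⟨o1, hex⟩⟩
  have q1 := le_max_left (X a) (X u)
  have q2 := le_max_right (X a) (X u)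
  have q3 := min_le_left (X b) (X v)
  have q4 := min_le_right (X b) (X v)
  have m1 : X a < m := by linarith
  have m2 : m < X b := by linarith
  have m3 : X u < m := by linarith
  have m4 : m < X v := by linarith
  have key : ∀ t, X a ≤ t → t ≤ X b → X u ≤ t → t ≤ X v →
      hgt X Y (u, v) t ≠ hgt X Y (a, b) t →
      (hgt X Y (u, v) t < hgt X Y (a, b) t ↔ hgt X Y (u, v) m < hgt X Y (a, b) m) := by
    intro t t1 t2 t3 t4 hn
    constructor
    · exact h.sign hg he hne t1 t2 t3 t4 m1 m2 m3 m4
    · intro hh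
      rcases lt_or_gt_of_ne hn with h' | h'
      · exact h'
      · have := h.sign he hg (Ne.symm hne) t3 t4 t1 t2 m3 m4 m1 m2 h'
        linarith
  set M := (hgt X Y (u, v) m < hgt X Y (a, b) m) with hM
  have hgu : hgt X Y (u, v) (X u) = Y u := by simp [hgt]
  have hga : hgt X Y (a, b) (X a) = Y a := by simp [hgt]
  have hgv : hgt X Y (u, v) (X v) = Y v := by rw [hgt_snd _ _ _ _ hex]; simp
  have hgb : hgt X Y (a, b) (X b) = Y b := by rw [hgt_snd _ _ _ _ hgx]; simp
  have left : ind (LInd X Y (u, v) (a, b)) + ind (LInd' X Y (u, v) (a, b))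
      + ind (TInd X Y (u, v) a) = ind M := by
    rcases lt_trichotomy (X a) (X u) with hx | hx | hx
    · have hau : a ≠ u := by rintro rfl; exact lt_irrefl _ hx
      rw [ind_false (P := LInd' _ _ _ _), ind_false (P := TInd _ _ _ _)]
      · have := key (X u) hx.le o1.le le_rfl hex.le
          (by rw [hgu]; exact (h.on_edge a b u hg hx o1).symm)
        rw [hgu] at this
        simp only [add_zero]
        congr 1
        simp [LInd, hx, o1, this, hM]
      · simp [TInd]; intro; linarith
      · simp [LInd', hau]
    · have hau : a = u := h.inj hx
      subst hau
      rw [ind_false (P := LInd _ _ _ _), ind_false (P := TInd _ _ _ _)]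
      · simp only [add_zero, zero_add]
        congr 1
        simp only [LInd', hM, true_and, hgt, eq_iff_iff, add_lt_add_iff_left]
        rw [mul_lt_mul_iff_right₀ (by linarith)]
      · simp [TInd]
      · simp [LInd]
    · have hau : a ≠ u := by rintro rfl; exact lt_irrefl _ hx
      rw [ind_false (P := LInd _ _ _ _), ind_false (P := LInd' _ _ _ _)]
      · have := key (X a) le_rfl hgx.le hx.le o2.le
          (by rw [hga]; exact (h.on_edge u v a he hx o2))
        rw [hga] at this
        simp only [zero_add]
        congr 1
        simp [TInd, hx, o2, this, hM]
      · simp [LInd', hau]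
      · simp [LInd]; intro; linarith
  have right : ind (RInd X Y (u, v) (a, b)) + ind (RInd' X Y (u, v) (a, b))
      + ind (TInd X Y (u, v) b) = ind M := by
    rcases lt_trichotomy (X b) (X v) with hx | hx | hx
    · have hau : b ≠ v := by rintro rfl; exact lt_irrefl _ hx
      rw [ind_false (P := RInd _ _ _ _), ind_false (P := RInd' _ _ _ _)]
      · have := key (X b) hgx.le le_rfl o1.le hx.le
          (by rw [hgb]; exact (h.on_edge u v b he o1 hx))
        rw [hgb] at this
        simp only [zero_add]
        congr 1
        simp [TInd, hx, o1, this, hM]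
      · simp [RInd', hau]
      · simp [RInd]; intro _ _; linarith
    · have hau : b = v := h.inj hx
      subst hau
      rw [ind_false (P := RInd _ _ _ _), ind_false (P := TInd _ _ _ _)]
      · simp only [add_zero, zero_add]
        congr 1
        simp only [RInd', hM, true_and, eq_iff_iff]
        rw [hgt_snd _ _ _ _ hex, hgt_snd _ _ _ _ hgx]
        simp only [add_lt_add_iff_left]
        constructor
        · intro; nlinarith
        · intro; nlinarith
      · simp [TInd]
      · simp [RInd]
    · have hau : b ≠ v := by rintro rfl; exact lt_irrefl _ hx
      rw [ind_false (P := RInd' _ _ _ _), ind_false (P := TInd _ _ _ _)]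
      · have := key (X v) o2.le hx.le hex.le le_rfl
          (by rw [hgv]; exact (h.on_edge a b v hg o2 hx).symm)
        rw [hgv] at this
        simp only [add_zero]
        congr 1
        simp [RInd, hx, o2, this, hM]
      · simp [TInd]; intro _ _; linarith
      · simp [RInd', hau]
  have two : ind M + ind M = 0 := CharTwo.add_self_eq_zero _
  linear_combination left + right + two

end Planar

section Faces

variable {V : Type} [Fintype V]

open Classical in
/-- edges oriented from left to right -/
noncomputable def orE (G : SimpleGraph V) (X : V → ℝ) : Finset (V × V) :=
  Finset.univ.filter (fun e => G.Adj e.1 e.2 ∧ X e.1 < X e.2)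

lemma mem_orE {G : SimpleGraph V} {X : V → ℝ} {e : V × V} :
    e ∈ orE G X ↔ G.Adj e.1 e.2 ∧ X e.1 < X e.2 := by
  simp [orE]

/-- `z` is an element of the cycle space -/
def IsCyc (G : SimpleGraph V) (X : V → ℝ) (z : V × V → ZMod 2) : Prop :=
  ∀ y, ∑ e ∈ orE G X, (ind (e.1 = y) + ind (e.2 = y)) * z e = 0

noncomputable def PV (G : SimpleGraph V) (X Y : V → ℝ) (v : V) (z : V × V → ZMod 2) : ZMod 2 :=
  ∑ g ∈ orE G X, ind (X g.1 < X v ∧ X v < X g.2 ∧ Y v < hgt X Y g (X v)) * z g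

noncomputable def UR (G : SimpleGraph V) (X Y : V → ℝ) (e : V × V) (z : V × V → ZMod 2) :
    ZMod 2 :=
  PV G X Y e.1 z + ∑ g ∈ orE G X, ind (g.1 = e.1 ∧ slp X Y e < slp X Y g) * z g

noncomputable def UL (G : SimpleGraph V) (X Y : V → ℝ) (e : V × V) (z : V × V → ZMod 2) :
    ZMod 2 :=
  PV G X Y e.2 z + ∑ g ∈ orE G X, ind (g.2 = e.2 ∧ slp X Y g < slp X Y e) * z g

lemma UR_eq_UL {G : SimpleGraph V} {X Y : V → ℝ} (h : Drawn G X Y) {e : V × V}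
    (he : e ∈ orE G X) {z : V × V → ZMod 2} (hz : IsCyc G X z) :
    UR G X Y e z = UL G X Y e z := by
  classical
  have h0 : ∑ y : V, ind (TInd X Y e y) *
      ∑ g ∈ orE G X, (ind (g.1 = y) + ind (g.2 = y)) * z g = 0 := by
    apply Finset.sum_eq_zero
    intro y _
    rw [hz y, mul_zero]
  have h1 : ∑ y : V, ind (TInd X Y e y) *
      ∑ g ∈ orE G X, (ind (g.1 = y) + ind (g.2 = y)) * z g =
      ∑ g ∈ orE G X, (ind (TInd X Y e g.1) + ind (TInd X Y e g.2)) * z g := by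
    simp_rw [Finset.mul_sum]
    rw [Finset.sum_comm]
    apply Finset.sum_congr rfl
    intro g _
    have aux : ∀ a : V, ∑ y : V, ind (TInd X Y e y) * ind (a = y) = ind (TInd X Y e a) := by
      intro a
      rw [Finset.sum_eq_single a]
      · rw [ind_true (P := a = a) rfl, mul_one]
      · intro b _ hb
        rw [ind_false (P := a = b) (Ne.symm hb), mul_zero]
      · simp
    rw [← aux g.1, ← aux g.2, ← Finset.sum_add_distrib, Finset.sum_mul]
    apply Finset.sum_congr rfl
    intro y _
    ring
  have h2 : UR G X Y e z + UL G X Y e z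
      + ∑ g ∈ orE G X, (ind (TInd X Y e g.1) + ind (TInd X Y e g.2)) * z g = 0 := by
    unfold UR UL PV
    rw [← Finset.sum_add_distrib, ← Finset.sum_add_distrib, ← Finset.sum_add_distrib,
      ← Finset.sum_add_distrib]
    apply Finset.sum_eq_zero
    intro g hg
    have := h.parity (mem_orE.1 he).1 (mem_orE.1 hg).1 (mem_orE.1 he).2 (mem_orE.1 hg).2
    unfold LInd LInd' RInd RInd' at this
    linear_combination z g * this
  rw [← h1, h0, add_zero] at h2
  exact CharTwo.add_eq_zero.1 h2

lemma slp_inj_left {G : SimpleGraph V} {X Y : V → ℝ} (h : Drawn G X Y) {e g : V × V}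
    (he : e ∈ orE G X) (hg : g ∈ orE G X) (h1 : e.1 = g.1) (hs : slp X Y e = slp X Y g) :
    e = g := by
  obtain ⟨he1, he2⟩ := mem_orE.1 he
  obtain ⟨hg1, hg2⟩ := mem_orE.1 hg
  by_contra hne
  have hlt : X e.1 < min (X e.2) (X g.2) := lt_min he2 (by rw [h1]; exact hg2)
  obtain ⟨t, t1, t2⟩ := exists_between hlt
  obtain ⟨t3, t4⟩ := lt_min_iff.1 t2
  refine h.cross e.1 e.2 g.1 g.2 t he1 hg1 t1 t3 (by rw [← h1]; exact t1) t4 hne ?_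
  have hs' : slp X Y (e.1, e.2) = slp X Y (g.1, g.2) := hs
  simp only [hgt, hs']
  rw [h1]

lemma slp_inj_right {G : SimpleGraph V} {X Y : V → ℝ} (h : Drawn G X Y) {e g : V × V}
    (he : e ∈ orE G X) (hg : g ∈ orE G X) (h1 : e.2 = g.2) (hs : slp X Y e = slp X Y g) :
    e = g := by
  obtain ⟨he1, he2⟩ := mem_orE.1 he
  obtain ⟨hg1, hg2⟩ := mem_orE.1 hg
  by_contra hne
  have hlt : max (X e.1) (X g.1) < X e.2 := max_lt he2 (by rw [h1]; exact hg2)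
  obtain ⟨t, t1, t2⟩ := exists_between hlt
  obtain ⟨t3, t4⟩ := max_lt_iff.1 t1
  refine h.cross e.1 e.2 g.1 g.2 t he1 hg1 t3 t2 t4 (by rw [← h1]; exact t2) hne ?_
  have hs' : slp X Y (e.1, e.2) = slp X Y (g.1, g.2) := hs
  rw [hgt_snd _ _ _ _ he2, hgt_snd _ _ _ _ hg2]
  simp only [hs']
  rw [h1]

lemma sum_ind_eq {G : SimpleGraph V} {X : V → ℝ} {e : V × V} (he : e ∈ orE G X)
    (z : V × V → ZMod 2) : ∑ g ∈ orE G X, ind (g = e) * z g = z e := by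
  rw [Finset.sum_eq_single e]
  · rw [ind_true rfl, one_mul]
  · intro b _ hb
    rw [ind_false hb, zero_mul]
  · exact fun h => absurd he h

/-- side functional of a dart; `true` is the rightward dart (upper side) -/
noncomputable def wd (G : SimpleGraph V) (X Y : V → ℝ) (d : (V × V) × Bool)
    (z : V × V → ZMod 2) : ZMod 2 :=
  UR G X Y d.1 z + if d.2 then 0 else z d.1

def dtail (d : (V × V) × Bool) : V := if d.2 then d.1.1 else d.1.2
def dhead (d : (V × V) × Bool) : V := if d.2 then d.1.2 else d.1.1

open Classical in
lemma exists_max_slp (X Y : V → ℝ) (S : Finset (V × V)) (hS : S.Nonempty) :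
    ∃ e ∈ S, ∀ g ∈ S, slp X Y g ≤ slp X Y e :=
  S.exists_max_image _ hS

lemma ind_congr_sum {G : SimpleGraph V} {X : V → ℝ} (z : V × V → ZMod 2)
    {P Q : V × V → Prop} (h : ∀ g ∈ orE G X, (P g ↔ Q g)) :
    ∑ g ∈ orE G X, ind (P g) * z g = ∑ g ∈ orE G X, ind (Q g) * z g := by
  apply Finset.sum_congr rfl
  intro g hg
  rw [propext (h g hg)]

lemma ind_split_sum {G : SimpleGraph V} {X : V → ℝ} (z : V × V → ZMod 2)
    {P Q : V × V → Prop} {e : V × V} (he : e ∈ orE G X)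
    (h : ∀ g ∈ orE G X, (P g ↔ Q g ∨ g = e)) (hQ : ¬ Q e) :
    ∑ g ∈ orE G X, ind (P g) * z g = (∑ g ∈ orE G X, ind (Q g) * z g) + z e := by
  rw [← sum_ind_eq he z, ← Finset.sum_add_distrib]
  apply Finset.sum_congr rfl
  intro g hg
  rw [← add_mul]
  congr 1
  by_cases hge : g = e
  · subst hge
    rw [ind_true ((h g hg).2 (Or.inr rfl)), ind_false hQ, ind_true rfl, zero_add]
  · rw [ind_false hge, add_zero, propext (h g hg)]
    simp [hge]

lemma ind_zero_sum {G : SimpleGraph V} {X : V → ℝ} (z : V × V → ZMod 2)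
    {P : V × V → Prop} (h : ∀ g ∈ orE G X, ¬ P g) :
    ∑ g ∈ orE G X, ind (P g) * z g = 0 := by
  apply Finset.sum_eq_zero
  intro g hg
  rw [ind_false (h g hg), zero_mul]

lemma IsCyc.eq {G : SimpleGraph V} {X : V → ℝ} {z : V × V → ZMod 2} (hz : IsCyc G X z) (y : V) :
    ∑ g ∈ orE G X, ind (g.1 = y) * z g = ∑ g ∈ orE G X, ind (g.2 = y) * z g := by
  have := hz y
  simp_rw [add_mul, Finset.sum_add_distrib] at this
  exact CharTwo.add_eq_zero.1 this

/-- Walking along a face. -/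
lemma exists_step {G : SimpleGraph V} {X Y : V → ℝ} (h : Drawn G X Y) (d : (V × V) × Bool)
    (hd : d.1 ∈ orE G X)
    (hdeg : ∃ g ∈ orE G X, g ≠ d.1 ∧ (g.1 = dhead d ∨ g.2 = dhead d)) :
    ∃ d' : (V × V) × Bool, d'.1 ∈ orE G X ∧ d'.1 ≠ d.1 ∧ dtail d' = dhead d ∧
      ∀ z, IsCyc G X z → wd G X Y d' z = wd G X Y d z := by
  classical
  obtain ⟨e, b⟩ := d
  obtain ⟨g0, hg0, hg0e, hg0v⟩ := hdeg
  simp only at hd hg0e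
  cases b with
  | true =>
    simp only [dhead, if_true] at hg0v
    simp only [dhead, if_true]
    by_cases hA : ((orE G X).filter (fun g => g.2 = e.2 ∧ slp X Y g < slp X Y e)).Nonempty
    · obtain ⟨e', he', hmax⟩ := exists_max_slp X Y _ hA
      obtain ⟨he'E, he'v, he's⟩ := Finset.mem_filter.1 he'
      refine ⟨(e', false), he'E, fun hh => by simp only at hh; rw [hh] at he's; exact lt_irrefl _ he's,
        by simp [dtail, he'v], fun z hz => ?_⟩
      simp only [wd, if_true, add_zero, Bool.false_eq_true, if_false]
      rw [UR_eq_UL h he'E hz, UR_eq_UL h hd hz]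
      unfold UL
      rw [he'v, add_assoc, ← ind_split_sum (P := fun g => g.2 = e.2 ∧ slp X Y g < slp X Y e) z he'E]
      · intro g hg
        constructor
        · rintro ⟨h1, h2⟩
          have := hmax g (Finset.mem_filter.2 ⟨hg, h1, h2⟩)
          rcases this.lt_or_eq with h3 | h3
          · exact Or.inl ⟨h1, h3⟩
          · exact Or.inr (slp_inj_right h hg he'E (h1.trans he'v.symm) h3)
        · rintro (⟨h1, h2⟩ | rfl)
          · exact ⟨h1, h2.trans he's⟩
          · exact ⟨he'v, he's⟩
      · simp
    · rw [Finset.not_nonempty_iff_eq_empty, Finset.filter_eq_empty_iff] at hA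
      have hUe : ∀ z, IsCyc G X z → UR G X Y e z = PV G X Y e.2 z := by
        intro z hz
        rw [UR_eq_UL h hd hz, UL, ind_zero_sum z (fun g hg => hA hg), add_zero]
      by_cases hB : ((orE G X).filter (fun g => g.1 = e.2)).Nonempty
      · obtain ⟨e', he', hmax⟩ := exists_max_slp X Y _ hB
        obtain ⟨he'E, he'v⟩ := Finset.mem_filter.1 he'
        refine ⟨(e', true), he'E, fun hh => ?_, by simp [dtail, he'v], fun z hz => ?_⟩
        · simp only at hh
          rw [hh] at he'v
          have := (mem_orE.1 hd).2
          rw [he'v] at this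
          exact lt_irrefl _ this
        · simp only [wd, if_true, add_zero]
          rw [hUe z hz, UR, ind_zero_sum z, add_zero, he'v]
          rintro g hg ⟨h1, h2⟩
          exact absurd (hmax g (Finset.mem_filter.2 ⟨hg, h1.trans he'v⟩)) (not_le.2 h2)
      · rw [Finset.not_nonempty_iff_eq_empty, Finset.filter_eq_empty_iff] at hB
        have hC : ((orE G X).filter (fun g => g.2 = e.2)).Nonempty :=
          ⟨e, Finset.mem_filter.2 ⟨hd, rfl⟩⟩
        obtain ⟨e', he', hmax⟩ := exists_max_slp X Y _ hC
        obtain ⟨he'E, he'v⟩ := Finset.mem_filter.1 he'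
        refine ⟨(e', false), he'E, fun hh => ?_, by simp [dtail, he'v], fun z hz => ?_⟩
        · simp only at hh
          subst hh
          have hg0' : g0.2 = e'.2 := hg0v.resolve_left (hB hg0)
          have h1 := hmax g0 (Finset.mem_filter.2 ⟨hg0, hg0'⟩)
          rcases h1.lt_or_eq with h3 | h3
          · exact hA hg0 ⟨hg0', h3⟩
          · exact hg0e (slp_inj_right h hg0 hd hg0' h3)
        · simp only [wd, if_true, add_zero, Bool.false_eq_true, if_false]
          rw [hUe z hz, UR_eq_UL h he'E hz, UL, he'v, add_assoc,
            ← ind_split_sum (P := fun g => g.2 = e.2) z he'E, ← hz.eq, ind_zero_sum z, add_zero]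
          · exact fun g hg => hB hg
          · intro g hg
            constructor
            · intro h1
              have := hmax g (Finset.mem_filter.2 ⟨hg, h1⟩)
              rcases this.lt_or_eq with h3 | h3
              · exact Or.inl ⟨h1, h3⟩
              · exact Or.inr (slp_inj_right h hg he'E (h1.trans he'v.symm) h3)
            · rintro (⟨h1, h2⟩ | rfl)
              · exact h1
              · exact he'v
          · simp
  | false =>
    simp only [dhead, Bool.false_eq_true, if_false] at hg0v
    simp only [dhead, Bool.false_eq_true, if_false]
    -- `UR e + z e` is the sum over slopes at least that of `e`
    have hUe : ∀ z, UR G X Y e z + z e = PV G X Y e.1 z +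
        ∑ g ∈ orE G X, ind (g.1 = e.1 ∧ slp X Y e ≤ slp X Y g) * z g := by
      intro z
      rw [UR, add_assoc, ← ind_split_sum (P := fun g => g.1 = e.1 ∧ slp X Y e ≤ slp X Y g) z hd]
      · intro g hg
        constructor
        · rintro ⟨h1, h2⟩
          rcases h2.lt_or_eq with h3 | h3
          · exact Or.inl ⟨h1, h3⟩
          · exact Or.inr (slp_inj_left h hg hd h1 h3.symm)
        · rintro (⟨h1, h2⟩ | rfl)
          · exact ⟨h1, h2.le⟩
          · exact ⟨rfl, le_rfl⟩
      · simp
    by_cases hA : ((orE G X).filter (fun g => g.1 = e.1 ∧ slp X Y g < slp X Y e)).Nonempty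
    · obtain ⟨e', he', hmax⟩ := exists_max_slp X Y _ hA
      obtain ⟨he'E, he'v, he's⟩ := Finset.mem_filter.1 he'
      refine ⟨(e', true), he'E, fun hh => by simp only at hh; rw [hh] at he's; exact lt_irrefl _ he's,
        by simp [dtail, he'v], fun z hz => ?_⟩
      simp only [wd, if_true, add_zero, Bool.false_eq_true, if_false]
      rw [hUe, UR, he'v]
      congr 1
      apply ind_congr_sum
      intro g hg
      constructor
      · rintro ⟨h1, h2⟩
        refine ⟨h1, ?_⟩
        by_contra h3
        exact absurd (hmax g (Finset.mem_filter.2 ⟨hg, h1, not_le.1 h3⟩)) (not_le.2 h2)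
      · rintro ⟨h1, h2⟩
        exact ⟨h1, lt_of_lt_of_le he's h2⟩
    · rw [Finset.not_nonempty_iff_eq_empty, Finset.filter_eq_empty_iff] at hA
      have hUe' : ∀ z, UR G X Y e z + z e = PV G X Y e.1 z +
          ∑ g ∈ orE G X, ind (g.1 = e.1) * z g := by
        intro z
        rw [hUe]
        congr 1
        apply ind_congr_sum
        intro g hg
        constructor
        · exact fun h1 => h1.1
        · intro h1
          refine ⟨h1, ?_⟩
          by_contra h3
          exact hA hg ⟨h1, not_le.1 h3⟩
      by_cases hB : ((orE G X).filter (fun g => g.2 = e.1)).Nonempty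
      · obtain ⟨e', he', hmax⟩ := exists_max_slp X Y _ hB
        obtain ⟨he'E, he'v⟩ := Finset.mem_filter.1 he'
        refine ⟨(e', false), he'E, fun hh => ?_, by simp [dtail, he'v], fun z hz => ?_⟩
        · simp only at hh
          rw [hh] at he'v
          have := (mem_orE.1 hd).2
          rw [he'v] at this
          exact lt_irrefl _ this
        · simp only [wd, Bool.false_eq_true, if_false]
          rw [hUe' z, UR_eq_UL h he'E hz, UL, he'v, add_assoc,
            ← ind_split_sum (P := fun g => g.2 = e.1) z he'E, hz.eq]
          · intro g hg
            constructor
            · intro h1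
              have := hmax g (Finset.mem_filter.2 ⟨hg, h1⟩)
              rcases this.lt_or_eq with h3 | h3
              · exact Or.inl ⟨h1, h3⟩
              · exact Or.inr (slp_inj_right h hg he'E (h1.trans he'v.symm) h3)
            · rintro (⟨h1, h2⟩ | rfl)
              · exact h1
              · exact he'v
          · simp
      · rw [Finset.not_nonempty_iff_eq_empty, Finset.filter_eq_empty_iff] at hB
        have hC : ((orE G X).filter (fun g => g.1 = e.1)).Nonempty :=
          ⟨e, Finset.mem_filter.2 ⟨hd, rfl⟩⟩
        obtain ⟨e', he', hmax⟩ := exists_max_slp X Y _ hC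
        obtain ⟨he'E, he'v⟩ := Finset.mem_filter.1 he'
        refine ⟨(e', true), he'E, fun hh => ?_, by simp [dtail, he'v], fun z hz => ?_⟩
        · simp only at hh
          subst hh
          have hg0' : g0.1 = e'.1 := hg0v.resolve_right (hB hg0)
          have h1 := hmax g0 (Finset.mem_filter.2 ⟨hg0, hg0'⟩)
          rcases h1.lt_or_eq with h3 | h3
          · exact hA hg0 ⟨hg0', h3⟩
          · exact hg0e (slp_inj_left h hg0 hd hg0' h3)
        · simp only [wd, if_true, add_zero, Bool.false_eq_true, if_false]
          rw [hUe' z, hz.eq, ind_zero_sum z (fun g hg => hB hg), UR, ind_zero_sum z, he'v]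
          rintro g hg ⟨h1, h2⟩
          exact absurd (hmax g (Finset.mem_filter.2 ⟨hg, h1.trans he'v⟩)) (not_le.2 h2)

end Faces

section Girth

variable {V : Type}

lemma noCyc3 {G : SimpleGraph V} (hg : 7 ≤ G.egirth) {a b c : V} (h1 : G.Adj a b)
    (h2 : G.Adj b c) (h3 : G.Adj c a) : False := by
  have := SimpleGraph.le_egirth.1 hg a (Walk.cons h1 (Walk.cons h2 (Walk.cons h3 Walk.nil))) (by
    have e1 := h1.ne; have e2 := h2.ne; have e3 := h3.ne
    simp [Walk.cons_isCycle_iff]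
    grind)
  revert this
  simp [Walk.length_cons]
  norm_cast

lemma noCyc4 {G : SimpleGraph V} (hg : 7 ≤ G.egirth) {a b c d : V} (h1 : G.Adj a b)
    (h2 : G.Adj b c) (h3 : G.Adj c d) (h4 : G.Adj d a) (k1 : a ≠ c) (k2 : b ≠ d) : False := by
  have := SimpleGraph.le_egirth.1 hg a
    (Walk.cons h1 (Walk.cons h2 (Walk.cons h3 (Walk.cons h4 Walk.nil)))) (by
    have e1 := h1.ne; have e2 := h2.ne; have e3 := h3.ne; have e4 := h4.ne
    simp [Walk.cons_isCycle_iff]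
    grind)
  revert this
  simp [Walk.length_cons]
  norm_cast

lemma noCyc5 {G : SimpleGraph V} (hg : 7 ≤ G.egirth) {a b c d e : V} (h1 : G.Adj a b)
    (h2 : G.Adj b c) (h3 : G.Adj c d) (h4 : G.Adj d e) (h5 : G.Adj e a)
    (k1 : a ≠ c) (k2 : b ≠ d) (k3 : c ≠ e) (k4 : a ≠ d) (k5 : b ≠ e) : False := by
  have := SimpleGraph.le_egirth.1 hg a
    (Walk.cons h1 (Walk.cons h2 (Walk.cons h3 (Walk.cons h4 (Walk.cons h5 Walk.nil))))) (by
    have e1 := h1.ne; have e2 := h2.ne; have e3 := h3.ne; have e4 := h4.ne; have e5 := h5.ne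
    simp [Walk.cons_isCycle_iff]
    grind)
  revert this
  simp [Walk.length_cons]
  norm_cast

lemma noCyc6 {G : SimpleGraph V} (hg : 7 ≤ G.egirth) {a b c d e f : V} (h1 : G.Adj a b)
    (h2 : G.Adj b c) (h3 : G.Adj c d) (h4 : G.Adj d e) (h5 : G.Adj e f) (h6 : G.Adj f a)
    (k1 : a ≠ c) (k2 : b ≠ d) (k3 : c ≠ e) (k4 : d ≠ f) (k5 : a ≠ d) (k6 : b ≠ e) (k7 : c ≠ f)
    (k8 : a ≠ e) (k9 : b ≠ f) : False := by
  have := SimpleGraph.le_egirth.1 hg a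
    (Walk.cons h1 (Walk.cons h2 (Walk.cons h3 (Walk.cons h4 (Walk.cons h5
      (Walk.cons h6 Walk.nil)))))) (by
    have e1 := h1.ne; have e2 := h2.ne; have e3 := h3.ne; have e4 := h4.ne; have e5 := h5.ne
    have e6 := h6.ne
    simp [Walk.cons_isCycle_iff]
    grind)
  revert this
  simp [Walk.length_cons]
  norm_cast

lemma distinct_of_girth {G : SimpleGraph V} (hg : 7 ≤ G.egirth) (p : ℕ → V)
    (ha : ∀ i, G.Adj (p i) (p (i + 1))) (hb : ∀ i, p i ≠ p (i + 2)) :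
    ∀ i j, i < j → j < 7 → p i ≠ p j := by
  have h1 : ∀ i, p i ≠ p (i + 1) := fun i => (ha i).ne
  have h3 : ∀ i, p i ≠ p (i + 3) := by
    intro i he
    have := ha (i + 2)
    simp only [add_assoc, Nat.reduceAdd, ← he] at this
    exact noCyc3 hg (ha i) (ha (i + 1)) this
  have h4 : ∀ i, p i ≠ p (i + 4) := by
    intro i he
    have := ha (i + 3)
    simp only [add_assoc, Nat.reduceAdd, ← he] at this
    exact noCyc4 hg (ha i) (ha (i + 1)) (ha (i + 2)) this (hb i) (hb (i + 1))
  have h5 : ∀ i, p i ≠ p (i + 5) := by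
    intro i he
    have := ha (i + 4)
    simp only [add_assoc, Nat.reduceAdd, ← he] at this
    exact noCyc5 hg (ha i) (ha (i + 1)) (ha (i + 2)) (ha (i + 3)) this (hb i) (hb (i + 1))
      (hb (i + 2)) (h3 i) (h3 (i + 1))
  have h6 : ∀ i, p i ≠ p (i + 6) := by
    intro i he
    have := ha (i + 5)
    simp only [add_assoc, Nat.reduceAdd, ← he] at this
    exact noCyc6 hg (ha i) (ha (i + 1)) (ha (i + 2)) (ha (i + 3)) (ha (i + 4)) this (hb i)
      (hb (i + 1)) (hb (i + 2)) (hb (i + 3)) (h3 i) (h3 (i + 1)) (h3 (i + 2)) (h4 i) (h4 (i + 1))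
  intro i j hij hj
  obtain ⟨k, rfl⟩ := Nat.exists_eq_add_of_lt hij
  have : k < 6 := by omega
  interval_cases k
  · exact h1 i
  · exact hb i
  · exact h3 i
  · exact h4 i
  · exact h5 i
  · exact h6 i

end Girth

section Euler

variable {V : Type} [Fintype V]

open Classical in
/-- All darts. -/
noncomputable def allD (G : SimpleGraph V) (X : V → ℝ) : Finset ((V × V) × Bool) :=
  orE G X ×ˢ Finset.univ

lemma card_allD (G : SimpleGraph V) (X : V → ℝ) : (allD G X).card = 2 * (orE G X).card := by
  simp [allD, Finset.card_product, mul_comm]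

lemma orE_of_adj {G : SimpleGraph V} {X : V → ℝ} (hX : Function.Injective X) {a b : V}
    (h : G.Adj a b) : (a, b) ∈ orE G X ∨ (b, a) ∈ orE G X := by
  rcases lt_or_gt_of_ne (fun hh => h.ne (hX hh) : X a ≠ X b) with h1 | h1
  · exact Or.inl (mem_orE.2 ⟨h, h1⟩)
  · exact Or.inr (mem_orE.2 ⟨h.symm, h1⟩)

lemma face_large {G : SimpleGraph V} {X Y : V → ℝ} (h : Drawn G X Y) (hg : 7 ≤ G.egirth)
    (hdeg : ∀ v u, G.Adj v u → ∃ w, w ≠ u ∧ G.Adj v w) (d : (V × V) × Bool)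
    (hd : d.1 ∈ orE G X) :
    ∃ F : Finset ((V × V) × Bool), 7 ≤ F.card ∧ ∀ d' ∈ F, d'.1 ∈ orE G X ∧
      ∀ z, IsCyc G X z → wd G X Y d' z = wd G X Y d z := by
  classical
  have adj : ∀ d : (V × V) × Bool, d.1 ∈ orE G X → G.Adj (dtail d) (dhead d) := by
    rintro ⟨e, b⟩ hd
    have := (mem_orE.1 hd).1
    cases b
    · simpa [dtail, dhead] using this.symm
    · simpa [dtail, dhead] using this
  have key : ∀ d : {d : (V × V) × Bool // d.1 ∈ orE G X},
      ∃ d' : {d : (V × V) × Bool // d.1 ∈ orE G X}, d'.1.1 ≠ d.1.1 ∧ dtail d'.1 = dhead d.1 ∧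
      ∀ z, IsCyc G X z → wd G X Y d'.1 z = wd G X Y d.1 z := by
    rintro ⟨d, hd⟩
    have hdeg' : ∃ g ∈ orE G X, g ≠ d.1 ∧ (g.1 = dhead d ∨ g.2 = dhead d) := by
      obtain ⟨w, hw, hadj⟩ := hdeg _ _ (adj d hd).symm
      have hne1 := hadj.ne
      obtain ⟨⟨a, b⟩, c⟩ := d
      rcases orE_of_adj h.inj hadj with h1 | h1
      · refine ⟨_, h1, ?_, Or.inl rfl⟩
        intro hh
        cases c <;> simp_all [dhead, dtail]
      · refine ⟨_, h1, ?_, Or.inr rfl⟩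
        intro hh
        cases c <;> simp_all [dhead, dtail]
    obtain ⟨d', h1, h2, h3, h4⟩ := exists_step h d hd hdeg'
    exact ⟨⟨d', h1⟩, h2, h3, h4⟩
  choose nx n1 n2 n3 using key
  let q : ℕ → {d : (V × V) × Bool // d.1 ∈ orE G X} := fun n => nx^[n] ⟨d, hd⟩
  have hq : ∀ n, q (n + 1) = nx (q n) := fun n => Function.iterate_succ_apply' _ _ _
  let p : ℕ → V := fun n => dtail (q n).1
  have hp : ∀ n, p (n + 1) = dhead (q n).1 := by
    intro n
    simp only [p, hq, n2]
  have hpa : ∀ i, G.Adj (p i) (p (i + 1)) := by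
    intro i
    rw [hp]
    exact adj _ (q i).2
  have hpb : ∀ i, p i ≠ p (i + 2) := by
    intro i he
    have e1 : p (i + 2) = dhead (q (i + 1)).1 := hp (i + 1)
    have e2 : dtail (q (i + 1)).1 = dhead (q i).1 := hp i
    have e3 : dtail (q i).1 = dhead (q (i + 1)).1 := he.trans e1
    have e4 : (q (i + 1)).1.1 ≠ (q i).1.1 := by rw [hq]; exact n1 _
    have o1 := (mem_orE.1 (q i).2).2
    have o2 := (mem_orE.1 (q (i + 1)).2).2
    revert e2 e3 e4 o1 o2
    generalize (q i).1 = x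
    generalize (q (i + 1)).1 = y
    obtain ⟨⟨x1, x2⟩, xb⟩ := x
    obtain ⟨⟨y1, y2⟩, yb⟩ := y
    intro e2 e3 e4 o1 o2
    cases xb <;> cases yb <;> simp [dhead, dtail] at e2 e3 e4 o1 o2
    · subst e2; subst e3; linarith
    · exact e4 e2 e3.symm
    · exact e4 e3.symm e2
    · subst e2; subst e3; linarith
  have hdist := distinct_of_girth hg p hpa hpb
  have hall : ∀ n, ∀ z, IsCyc G X z → wd G X Y (q n).1 z = wd G X Y d z := by
    intro n
    induction n with
    | zero => intro z _; rfl
    | succ n ih =>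
      intro z hz
      rw [hq, n3 _ z hz, ih z hz]
  refine ⟨(Finset.range 7).image (fun n => (q n).1), ?_, ?_⟩
  · rw [Finset.card_image_of_injOn]
    · simp
    · intro i hi j hj hij
      simp only [Finset.coe_range, Set.mem_Iio] at hi hj
      simp only at hij
      have hpij : p i = p j := by simp only [p, hij]
      rcases lt_trichotomy i j with h1 | h1 | h1
      · exact absurd hpij (hdist i j h1 hj)
      · exact h1
      · exact absurd hpij.symm (hdist j i h1 hi)
  · intro d' hd'
    obtain ⟨n, -, rfl⟩ := Finset.mem_image.1 hd'
    exact ⟨(q n).2, hall n⟩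

open Classical in
noncomputable def extz (G : SimpleGraph V) (X : V → ℝ) (z : orE G X → ZMod 2) :
    V × V → ZMod 2 := fun g => if h : g ∈ orE G X then z ⟨g, h⟩ else 0

lemma extz_sum (G : SimpleGraph V) (X : V → ℝ) (z : orE G X → ZMod 2) (c : V × V → ZMod 2) :
    ∑ g ∈ orE G X, c g * extz G X z g = ∑ g : orE G X, c g.1 * z g := by
  rw [← Finset.sum_coe_sort]
  apply Finset.sum_congr rfl
  intro g _
  simp [extz]

/-- boundary map -/
noncomputable def bdry (G : SimpleGraph V) (X : V → ℝ) :
    (orE G X → ZMod 2) →ₗ[ZMod 2] ({v : V // ∃ u, G.Adj v u} → ZMod 2) where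
  toFun z := fun y => ∑ g : orE G X, (ind (g.1.1 = y.1) + ind (g.1.2 = y.1)) * z g
  map_add' z z' := by
    ext y
    simp [mul_add, Finset.sum_add_distrib]
  map_smul' c z := by
    ext y
    simp only [Pi.smul_apply, smul_eq_mul, RingHom.id_apply, Finset.mul_sum]
    apply Finset.sum_congr rfl
    intro g _
    ring

open Classical in
lemma euler_bound {G : SimpleGraph V} {X Y : V → ℝ} (h : Drawn G X Y) (hg : 7 ≤ G.egirth)
    (hdeg : ∀ v u, G.Adj v u → ∃ w, w ≠ u ∧ G.Adj v w) (hne : ∃ v u, G.Adj v u) :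
    5 * (orE G X).card < 7 * Fintype.card {v : V // ∃ u, G.Adj v u} := by
  set Z := LinearMap.ker (bdry G X) with hZ
  have hcyc : ∀ z ∈ Z, IsCyc G X (extz G X z) := by
    intro z hz y
    rw [extz_sum G X z (fun e => ind (e.1 = y) + ind (e.2 = y))]
    by_cases hy : ∃ u, G.Adj y u
    · exact congrFun (LinearMap.mem_ker.1 hz) ⟨y, hy⟩
    · apply Finset.sum_eq_zero
      intro g _
      have hadj := (mem_orE.1 g.2).1
      rw [ind_false, ind_false]
      · simp
      · rintro rfl; exact hy ⟨_, hadj.symm⟩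
      · rintro rfl; exact hy ⟨_, hadj⟩
  -- the functionals
  let Φ : (V × V) × Bool → (Z → ZMod 2) := fun d z => wd G X Y d (extz G X z.1)
  set W := (allD G X).image Φ with hW
  have hWcard : 7 * W.card ≤ (allD G X).card := by
    apply Finset.mul_card_image_le_card
    intro φ hφ
    obtain ⟨d, hd, rfl⟩ := Finset.mem_image.1 hφ
    have hdE : d.1 ∈ orE G X := by simpa [allD] using hd
    obtain ⟨F, hF7, hF⟩ := face_large h hg hdeg d hdE
    refine hF7.trans (Finset.card_le_card ?_)
    intro d' hd'
    obtain ⟨h1, h2⟩ := hF d' hd'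
    refine Finset.mem_filter.2 ⟨by simpa [allD] using h1, ?_⟩
    funext z
    exact h2 _ (hcyc z.1 z.2)
  rw [card_allD] at hWcard
  have hZcard : 2 ^ Module.finrank (ZMod 2) Z ≤ 2 ^ W.card := by
    have e1 : Fintype.card Z = 2 ^ Module.finrank (ZMod 2) Z := by
      rw [Module.card_eq_pow_finrank (K := ZMod 2), ZMod.card]
    have e2 : Fintype.card (W → ZMod 2) = 2 ^ W.card := by
      rw [Fintype.card_fun, ZMod.card, Fintype.card_coe]
    rw [← e1, ← e2]
    apply Fintype.card_le_of_injective (fun z => fun φ : W => φ.1 z)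
    intro z z' hzz
    have hval : ∀ d : (V × V) × Bool, d.1 ∈ orE G X →
        wd G X Y d (extz G X z.1) = wd G X Y d (extz G X z'.1) := by
      intro d hd
      have hm : Φ d ∈ W := Finset.mem_image_of_mem _ (by simpa [allD] using hd)
      exact congrFun hzz ⟨Φ d, hm⟩
    apply Subtype.ext
    funext g
    have v1 := hval (g.1, true) g.2
    have v2 := hval (g.1, false) g.2
    simp only [wd, if_true, add_zero, Bool.false_eq_true, if_false] at v1 v2
    rw [v1] at v2
    have v3 := add_left_cancel v2
    simpa [extz] using v3
  have hZW : Module.finrank (ZMod 2) Z ≤ W.card := (Nat.pow_le_pow_iff_right (by norm_num)).1 hZcard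
  -- rank of the boundary map
  let s : ({v : V // ∃ u, G.Adj v u} → ZMod 2) →ₗ[ZMod 2] ZMod 2 := ∑ y : {v : V // ∃ u, G.Adj v u}, LinearMap.proj y
  have hs : ∀ x, s x = ∑ y : {v : V // ∃ u, G.Adj v u}, x y := by intro x; simp [s]
  have hrk := LinearMap.finrank_range_add_finrank_ker (bdry G X)
  have hsk := LinearMap.finrank_range_add_finrank_ker s
  have hsurj : LinearMap.range s = ⊤ := by
    rw [LinearMap.range_eq_top]
    intro c
    obtain ⟨v, u, hvu⟩ := hne
    refine ⟨Pi.single ⟨v, u, hvu⟩ c, ?_⟩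
    rw [hs]
    simp
  have hle : LinearMap.range (bdry G X) ≤ LinearMap.ker s := by
    rintro _ ⟨z, rfl⟩
    rw [LinearMap.mem_ker, hs]
    simp only [bdry, LinearMap.coe_mk, AddHom.coe_mk]
    rw [Finset.sum_comm]
    apply Finset.sum_eq_zero
    intro g _
    have hadj := (mem_orE.1 g.2).1
    have aux : ∀ a : V, (∃ u, G.Adj a u) → ∑ y : {v : V // ∃ u, G.Adj v u}, ind (a = y.1) = 1 := by
      intro a ha
      rw [Finset.sum_eq_single ⟨a, ha⟩]
      · exact ind_true rfl
      · intro b _ hb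
        exact ind_false (fun hh => hb (Subtype.ext hh.symm))
      · simp
    rw [← Finset.sum_mul, Finset.sum_add_distrib, aux _ ⟨_, hadj⟩, aux _ ⟨_, hadj.symm⟩,
      CharTwo.add_self_eq_zero, zero_mul]
  have hle' := Submodule.finrank_mono hle
  rw [hsurj, finrank_top, Module.finrank_self, Module.finrank_fintype_fun_eq_card] at hsk
  rw [Module.finrank_fintype_fun_eq_card, Fintype.card_coe] at hrk
  rw [← hZ] at hrk
  have hsk' : 1 + Module.finrank (ZMod 2) (LinearMap.ker s)
      = Fintype.card {v : V // ∃ u, G.Adj v u} := by convert hsk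
  omega

lemma card_orE [DecidableEq V] (G : SimpleGraph V) [DecidableRel G.Adj] {X : V → ℝ}
    (hX : Function.Injective X) : ∑ v, G.degree v = 2 * (orE G X).card := by
  rw [SimpleGraph.sum_degrees_eq_twice_card_edges]
  congr 1
  symm
  apply Finset.card_bij (fun e _ => s(e.1, e.2))
  · intro e he
    simpa using (mem_orE.1 he).1
  · intro e he g hg heg
    rcases Sym2.eq_iff.1 heg with ⟨h1, h2⟩ | ⟨h1, h2⟩
    · exact Prod.ext h1 h2
    · have := (mem_orE.1 he).2
      have := (mem_orE.1 hg).2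
      rw [h1, h2] at *
      linarith
  · intro e he
    induction e with
    | _ a b =>
      have hab : G.Adj a b := by simpa using he
      rcases orE_of_adj hX hab with h1 | h1
      · exact ⟨_, h1, rfl⟩
      · exact ⟨_, h1, Sym2.eq_swap⟩

end Euler

/-! ### Part 2: reducible configurations -/

section Red

variable {V : Type} [Fintype V] [DecidableEq V]

def ProperOn (G : SimpleGraph V) (L : V → Finset ℕ) (φ : V → ℕ) (A : Finset V) : Prop :=
  (∀ v ∈ A, φ v ∈ L v) ∧ ∀ u ∈ A, ∀ v ∈ A, TwoDistAdj G u v → φ u ≠ φ v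

lemma TwoDistAdj.symm {G : SimpleGraph V} {u v : V} (h : TwoDistAdj G u v) :
    TwoDistAdj G v u := by
  obtain ⟨h1, h2 | ⟨w, h3, h4⟩⟩ := h
  · exact ⟨h1.symm, Or.inl h2.symm⟩
  · exact ⟨h1.symm, Or.inr ⟨w, h4.symm, h3.symm⟩⟩

open Classical in
/-- coloured vertices seen by `s` -/
noncomputable def seen (G : SimpleGraph V) (A : Finset V) (s : V) : Finset V :=
  A.filter (fun y => TwoDistAdj G s y)

lemma extend_one {G : SimpleGraph V} {L : V → Finset ℕ} {φ : V → ℕ} {A : Finset V}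
    (h : ProperOn G L φ A) {s : V} (hs : s ∉ A) (hc : (seen G A s).card < (L s).card) :
    ∃ φ', ProperOn G L φ' (insert s A) := by
  have : ∃ c ∈ L s, c ∉ (seen G A s).image φ := by
    by_contra hcon
    push Not at hcon
    have := Finset.card_le_card (fun c hc => hcon c hc : L s ⊆ (seen G A s).image φ)
    have := Finset.card_image_le (s := seen G A s) (f := φ)
    omega
  obtain ⟨c, hcL, hcn⟩ := this
  have hval : ∀ v ∈ A, Function.update φ s c v = φ v := by
    intro v hv
    rw [Function.update_of_ne]
    rintro rfl
    exact hs hv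
  have hnew : ∀ v ∈ A, TwoDistAdj G s v → c ≠ φ v := by
    intro v hv hsv hcv
    exact hcn (Finset.mem_image.2 ⟨v, by simp [seen, hv, hsv], hcv.symm⟩)
  refine ⟨Function.update φ s c, ?_, ?_⟩
  · intro v hv
    rcases Finset.mem_insert.1 hv with rfl | hv
    · simpa using hcL
    · rw [hval v hv]; exact h.1 v hv
  · intro u hu v hv huv
    rcases Finset.mem_insert.1 hu with rfl | hu' <;> rcases Finset.mem_insert.1 hv with rfl | hv'
    · exact absurd rfl huv.1
    · rw [hval v hv', Function.update_self]
      exact hnew v hv' huv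
    · rw [hval u hu', Function.update_self]
      exact (hnew u hu' huv.symm).symm
    · rw [hval u hu', hval v hv']
      exact h.2 u hu' v hv' huv

def okL (c : V → ℕ) (K : ℕ) : ℕ → List V → Prop
  | _, [] => True
  | i, s :: l => c s + i < K ∧ okL c K (i + 1) l

lemma extend_list {G : SimpleGraph V} {L : V → Finset ℕ} {c : V → ℕ} {K : ℕ}
    (hL : ∀ v, K ≤ (L v).card) : ∀ (l : List V) (i : ℕ) (A : Finset V) (φ : V → ℕ),
    ProperOn G L φ A → l.Nodup → (∀ s ∈ l, s ∉ A) → (∀ s ∈ l, (seen G A s).card ≤ c s + i) →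
    okL c K i l → ∃ φ', ProperOn G L φ' (A ∪ l.toFinset) := by
  intro l
  induction l with
  | nil =>
    intro i A φ h _ _ _ _
    exact ⟨φ, by simpa using h⟩
  | cons s l ih =>
    intro i A φ h hnd hA hseen hok
    obtain ⟨hs1, hs2⟩ := List.nodup_cons.1 hnd
    obtain ⟨φ1, h1⟩ := extend_one h (hA s (by simp))
      (lt_of_le_of_lt (hseen s (by simp)) (lt_of_lt_of_le hok.1 (hL s)))
    obtain ⟨φ2, h2⟩ := ih (i + 1) (insert s A) φ1 h1 hs2 (by
        intro x hx hxA
        rcases Finset.mem_insert.1 hxA with rfl | hxA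
        · exact hs1 hx
        · exact hA x (by simp [hx]) hxA) (by
        intro x hx
        have h3 := hseen x (by simp [hx])
        have h4 : (seen G (insert s A) x).card ≤ (insert s (seen G A x)).card := by
          apply Finset.card_le_card
          intro y hy
          simp only [seen, Finset.mem_filter, Finset.mem_insert] at hy ⊢
          tauto
        have := Finset.card_insert_le s (seen G A x)
        omega) hok.2
    refine ⟨φ2, ?_⟩
    have : A ∪ (s :: l).toFinset = insert s A ∪ l.toFinset := by
      ext y; simp
    rw [this]
    exact h2

/-- all lists of size `D + 3` are fine -/
def Chs (G : SimpleGraph V) (D : ℕ) : Prop :=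
  ∀ L : V → Finset ℕ, (∀ v, D + 3 ≤ (L v).card) → ∃ φ : V → ℕ, IsTwoDistListColoring G L φ

lemma ext_color {H H' : SimpleGraph V} {D : ℕ} (hH' : Chs H' D) (l : List V) (hl : l.Nodup)
    (hpres : ∀ x y, x ∉ l → y ∉ l → TwoDistAdj H x y → TwoDistAdj H' x y) (c : V → ℕ)
    (hc : ∀ s ∈ l, (seen H (l.toFinset)ᶜ s).card ≤ c s) (hok : okL c (D + 3) 0 l) :
    Chs H D := by
  intro L hL
  obtain ⟨φ, h1, h2⟩ := hH' L hL
  have hp : ProperOn H L φ (l.toFinset)ᶜ := by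
    refine ⟨fun v _ => h1 v, fun u hu v hv huv => h2 u v (hpres u v ?_ ?_ huv)⟩
    · simpa using hu
    · simpa using hv
  obtain ⟨φ', h3, h4⟩ := extend_list hL l 0 _ φ hp hl (by simp) (by simpa using hc) hok
  rw [Finset.union_comm, Finset.union_compl] at h3 h4
  exact ⟨φ', fun v => h3 v (Finset.mem_univ _),
    fun u v => h4 u (Finset.mem_univ _) v (Finset.mem_univ _)⟩

variable (H : SimpleGraph V) [DecidableRel H.Adj]

/-- sum of the degrees of the neighbours -/
def sdeg (v : V) : ℕ := ∑ x ∈ H.neighborFinset v, H.degree x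

lemma card_ball_le {u x : V} (hux : H.Adj u x) :
    (insert x ((H.neighborFinset x).erase u)).card ≤ H.degree x := by
  refine (Finset.card_insert_le _ _).trans ?_
  have hm : u ∈ H.neighborFinset x := by simpa using hux.symm
  rw [Finset.card_erase_of_mem hm, H.card_neighborFinset_eq_degree]
  have : 0 < H.degree x := by
    rw [← H.card_neighborFinset_eq_degree]; exact Finset.card_pos.2 ⟨u, hm⟩
  omega

lemma card_balls_le (u : V) (B : Finset V) (hB : ∀ x ∈ B, H.Adj u x) :
    (B.biUnion (fun x => insert x ((H.neighborFinset x).erase u))).card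
      ≤ ∑ x ∈ B, H.degree x :=
  Finset.card_biUnion_le.trans (Finset.sum_le_sum fun x hx => card_ball_le H (hB x hx))

variable {H}

lemma lt_delete {u v : V} (huv : H.Adj u v) (S : Set (Sym2 V)) (hS : s(u, v) ∈ S) :
    H.deleteEdges S < H := by
  refine lt_of_le_of_ne (SimpleGraph.deleteEdges_le _) ?_
  intro h
  have : (H.deleteEdges S).Adj u v := by rw [h]; exact huv
  rw [SimpleGraph.deleteEdges_adj] at this
  exact this.2 hS

lemma red_leaf {D : ℕ} (hmin : ∀ H' < H, Chs H' D) (hD : ∀ v, H.degree v ≤ D) {u : V}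
    (hu : H.degree u = 1) : Chs H D := by
  rw [← H.card_neighborFinset_eq_degree] at hu
  obtain ⟨x, hx⟩ := Finset.card_eq_one.1 hu
  have hux : H.Adj u x := by
    have : x ∈ H.neighborFinset u := by rw [hx]; simp
    simpa using this
  refine ext_color (hmin _ (lt_delete hux {s(u, x)} rfl)) [u] (by simp) ?_ (fun _ => D) ?_ ?_
  · intro a b ha hb hab
    simp only [List.mem_singleton] at ha hb
    obtain ⟨h1, h2 | ⟨w, h3, h4⟩⟩ := hab
    · refine ⟨h1, Or.inl ?_⟩
      rw [SimpleGraph.deleteEdges_adj]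
      refine ⟨h2, ?_⟩
      simp [ha, hb]
    · have hwu : w ≠ u := by
        rintro rfl
        have e1 : a ∈ H.neighborFinset w := by simpa using h3.symm
        have e2 : b ∈ H.neighborFinset w := by simpa using h4
        rw [hx, Finset.mem_singleton] at e1 e2
        exact h1 (e1.trans e2.symm)
      refine ⟨h1, Or.inr ⟨w, ?_, ?_⟩⟩ <;> rw [SimpleGraph.deleteEdges_adj]
      · exact ⟨h3, by simp [ha, hwu]⟩
      · exact ⟨h4, by simp [hb, hwu]⟩
  · intro s hs
    rw [List.mem_singleton] at hs
    subst hs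
    have h1 := card_balls_le H s {x} (by simpa using hux)
    rw [Finset.sum_singleton] at h1
    refine le_trans (Finset.card_le_card ?_) (h1.trans (hD x))
    intro y hy
    simp only [seen, Finset.mem_filter] at hy
    obtain ⟨-, hsy, h2 | ⟨w, h3, h4⟩⟩ := hy
    · have : y ∈ H.neighborFinset s := by simpa using h2
      rw [hx, Finset.mem_singleton] at this
      subst this
      simp
    · have : w ∈ H.neighborFinset s := by simpa using h3
      rw [hx, Finset.mem_singleton] at this
      subst this
      simp [h4, hsy.symm]
  · simp [okL]

lemma red {D : ℕ} (hmin : ∀ H' < H, Chs H' D) (u : V) (T : Finset V) (hT : T.Nonempty)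
    (hadj : ∀ v ∈ T, H.Adj u v) (hdeg : ∀ v ∈ T, H.degree v = 2) (l : List V) (hl : l.Nodup)
    (hlT : l.toFinset = insert u T) (c : V → ℕ)
    (hcu : T.card + ∑ x ∈ H.neighborFinset u \ T, H.degree x ≤ c u)
    (hcv : ∀ v ∈ T, (sdeg H v - H.degree u) + (H.neighborFinset u \ T).card ≤ c v)
    (hok : okL c (D + 3) 0 l) : Chs H D := by
  have hml : ∀ x, x ∈ l ↔ x = u ∨ x ∈ T := by
    intro x
    rw [← List.mem_toFinset, hlT, Finset.mem_insert]
  obtain ⟨v0, hv0⟩ := hT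
  let S : Set (Sym2 V) := {e | ∃ v ∈ T, e = s(u, v)}
  refine ext_color (hmin _ (lt_delete (hadj v0 hv0) S ⟨v0, hv0, rfl⟩)) l hl ?_ c ?_ hok
  · intro a b ha hb hab
    rw [hml] at ha hb
    push Not at ha hb
    have hS : ∀ w, s(a, w) ∉ S := by
      rintro w ⟨v, hv, he⟩
      rcases Sym2.eq_iff.1 he with ⟨h1, h2⟩ | ⟨h1, h2⟩
      · exact ha.1 h1
      · exact ha.2 (h1 ▸ hv)
    have hS' : ∀ w, s(w, b) ∉ S := by
      rintro w ⟨v, hv, he⟩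
      rcases Sym2.eq_iff.1 he with ⟨h1, h2⟩ | ⟨h1, h2⟩
      · exact hb.2 (h2 ▸ hv)
      · exact hb.1 h2
    obtain ⟨h1, h2 | ⟨w, h3, h4⟩⟩ := hab
    · exact ⟨h1, Or.inl ((SimpleGraph.deleteEdges_adj ..).2 ⟨h2, hS b⟩)⟩
    · exact ⟨h1, Or.inr ⟨w, (SimpleGraph.deleteEdges_adj ..).2 ⟨h3, hS w⟩,
        (SimpleGraph.deleteEdges_adj ..).2 ⟨h4, hS' w⟩⟩⟩
  · intro s hs
    rw [hml] at hs
    rcases hs with rfl | hs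
    · refine le_trans ?_ hcu
      have h1 := card_balls_le H s (H.neighborFinset s \ T) (by
        intro x hx; simpa using (Finset.mem_sdiff.1 hx).1)
      have h2 : (T.biUnion (fun v => (H.neighborFinset v).erase s)).card ≤ T.card := by
        refine Finset.card_biUnion_le.trans ?_
        rw [Finset.card_eq_sum_ones]
        apply Finset.sum_le_sum
        intro v hv
        rw [Finset.card_erase_of_mem (by simpa using (hadj v hv).symm),
          H.card_neighborFinset_eq_degree, hdeg v hv]
      refine le_trans (Finset.card_le_card ?_)
        ((Finset.card_union_le _ _).trans (add_le_add h2 h1))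
      intro y hy
      simp only [seen, Finset.mem_filter, Finset.mem_compl, List.mem_toFinset, hml] at hy
      push Not at hy
      obtain ⟨⟨hys, hyT⟩, -, h3 | ⟨w, h4, h5⟩⟩ := hy
      · refine Finset.mem_union_right _ (Finset.mem_biUnion.2 ⟨y, ?_, by simp⟩)
        simp [h3, hyT]
      · by_cases hw : w ∈ T
        · refine Finset.mem_union_left _ (Finset.mem_biUnion.2 ⟨w, hw, ?_⟩)
          simp [h5, hys]
        · refine Finset.mem_union_right _ (Finset.mem_biUnion.2 ⟨w, ?_, ?_⟩)
          · simp [h4, hw]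
          · simp [h5, hys]
    · refine le_trans ?_ (hcv s hs)
      have hus : u ∈ H.neighborFinset s := by simpa using (hadj s hs).symm
      have h1 := card_balls_le H s ((H.neighborFinset s).erase u) (by
        intro x hx; simpa using (Finset.mem_erase.1 hx).2)
      have h2 : ∑ x ∈ (H.neighborFinset s).erase u, H.degree x = sdeg H s - H.degree u := by
        rw [sdeg, ← Finset.add_sum_erase _ _ hus]; omega
      rw [h2] at h1
      refine le_trans (Finset.card_le_card ?_)
        ((Finset.card_union_le _ (H.neighborFinset u \ T)).trans (add_le_add h1 le_rfl))
      intro y hy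
      simp only [seen, Finset.mem_filter, Finset.mem_compl, List.mem_toFinset, hml] at hy
      push Not at hy
      obtain ⟨⟨hys, hyT⟩, hsy, h3 | ⟨w, h4, h5⟩⟩ := hy
      · refine Finset.mem_union_left _ (Finset.mem_biUnion.2 ⟨y, ?_, by simp⟩)
        simp [h3, hys]
      · by_cases hw : w = u
        · subst hw
          refine Finset.mem_union_right _ ?_
          simp [h5, hyT]
        · refine Finset.mem_union_left _ (Finset.mem_biUnion.2 ⟨w, ?_, ?_⟩)
          · simp [h4, hw]
          · simp [h5, hsy.symm]

end Red

section Config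

variable {V : Type} [Fintype V] [DecidableEq V] {H : SimpleGraph V} [DecidableRel H.Adj]

lemma sorted_three {α : Type} [DecidableEq α] (f : α → ℕ) (S : Finset α) (hS : S.card = 3) :
    ∃ a b c, a ≠ b ∧ a ≠ c ∧ b ≠ c ∧ S = {a, b, c} ∧ f a ≤ f b ∧ f b ≤ f c := by
  obtain ⟨a, b, c, h1, h2, h3, rfl⟩ := Finset.card_eq_three.1 hS
  have e1 : ({a, b, c} : Finset α) = {a, c, b} := by ext; simp; tauto
  have e2 : ({a, b, c} : Finset α) = {b, a, c} := by ext; simp; tauto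
  have e3 : ({a, b, c} : Finset α) = {b, c, a} := by ext; simp; tauto
  have e4 : ({a, b, c} : Finset α) = {c, a, b} := by ext; simp; tauto
  have e5 : ({a, b, c} : Finset α) = {c, b, a} := by ext; simp; tauto
  rcases le_total (f a) (f b) with q1 | q1 <;> rcases le_total (f a) (f c) with q2 | q2 <;>
    rcases le_total (f b) (f c) with q3 | q3
  · exact ⟨a, b, c, h1, h2, h3, rfl, q1, q3⟩
  · exact ⟨a, c, b, h2, h1, h3.symm, e1, q2, q3⟩
  · exact ⟨a, b, c, h1, h2, h3, rfl, q1, q3⟩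
  · exact ⟨c, a, b, h2.symm, h3.symm, h1, e4, q2, q1⟩
  · exact ⟨b, a, c, h1.symm, h3, h2, e2, q1, q2⟩
  · exact ⟨c, b, a, h3.symm, h2.symm, h1.symm, e5, q3, q1⟩
  · exact ⟨b, c, a, h3, h1.symm, h2.symm, e3, q3, q2⟩
  · exact ⟨c, b, a, h3.symm, h2.symm, h1.symm, e5, q3, q1⟩

lemma sorted_four {α : Type} [DecidableEq α] (f : α → ℕ) (S : Finset α) (hS : S.card = 4) :
    ∃ a b c d, a ≠ b ∧ a ≠ c ∧ a ≠ d ∧ b ≠ c ∧ b ≠ d ∧ c ≠ d ∧ S = {a, b, c, d} ∧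
      f a ≤ f b ∧ f b ≤ f c ∧ f c ≤ f d := by
  obtain ⟨d, hd, hmax⟩ := S.exists_max_image f (Finset.card_pos.1 (by omega))
  obtain ⟨a, b, c, h1, h2, h3, he, q1, q2⟩ := sorted_three f (S.erase d) (by
    rw [Finset.card_erase_of_mem hd]; omega)
  have hm : ∀ x ∈ S.erase d, x ≠ d ∧ f x ≤ f d := fun x hx =>
    ⟨Finset.ne_of_mem_erase hx, hmax x (Finset.mem_of_mem_erase hx)⟩
  rw [he] at hm
  refine ⟨a, b, c, d, h1, h2, (hm a (by simp)).1, h3, (hm b (by simp)).1, (hm c (by simp)).1,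
    ?_, q1, q2, (hm c (by simp)).2⟩
  rw [← Finset.insert_erase hd, he]
  ext; simp; tauto

lemma mem_nb {u x : V} {S : Finset V} (hN : H.neighborFinset u = S) (hx : x ∈ S) :
    H.Adj u x := by
  rw [← hN] at hx
  simpa using hx

lemma two_vertex {u v : V} (huv : H.Adj u v) (hv : H.degree v = 2) :
    ∃ w, w ≠ u ∧ H.Adj v w ∧ H.neighborFinset v = {u, w} ∧ sdeg H v = H.degree u + H.degree w := by
  have hm : u ∈ H.neighborFinset v := by simpa using huv.symm
  have hc : ((H.neighborFinset v).erase u).card = 1 := by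
    rw [Finset.card_erase_of_mem hm, H.card_neighborFinset_eq_degree, hv]
  obtain ⟨w, hw⟩ := Finset.card_eq_one.1 hc
  have hwm : w ∈ (H.neighborFinset v).erase u := by rw [hw]; simp
  have hne := Finset.ne_of_mem_erase hwm
  have hN : H.neighborFinset v = {u, w} := by rw [← Finset.insert_erase hm, hw]
  refine ⟨w, hne, mem_nb rfl (Finset.mem_of_mem_erase hwm), hN, ?_⟩
  rw [sdeg, hN, Finset.sum_pair hne.symm]

lemma t_le {D : ℕ} (hD : ∀ v, H.degree v ≤ D) {u v : V} (huv : H.Adj u v)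
    (hv : H.degree v = 2) : sdeg H v - H.degree u ≤ D := by
  obtain ⟨w, -, -, -, h⟩ := two_vertex huv hv
  have := hD w
  omega

/-- the cost function used in all configurations -/
def cst (H : SimpleGraph V) [DecidableRel H.Adj] (u : V) (A k : ℕ) (s : V) : ℕ :=
  if s = u then A else (sdeg H s - H.degree u) + k

lemma red' {D : ℕ} (hmin : ∀ H' < H, Chs H' D) (u : V) (T B : Finset V) (hT : T.Nonempty)
    (hTB : Disjoint T B) (hN : H.neighborFinset u = T ∪ B)
    (hdeg : ∀ v ∈ T, H.degree v = 2) (l : List V) (hl : l.Nodup)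
    (hlT : l.toFinset = insert u T)
    (hok : okL (cst H u (T.card + ∑ x ∈ B, H.degree x) B.card) (D + 3) 0 l) : Chs H D := by
  have hB : H.neighborFinset u \ T = B := by
    rw [hN, Finset.union_sdiff_left, Finset.sdiff_eq_self_iff_disjoint]
    exact hTB.symm
  have hadj : ∀ v ∈ T, H.Adj u v := fun v hv => mem_nb hN (Finset.mem_union_left _ hv)
  refine red hmin u T hT hadj hdeg l hl hlT _ ?_ ?_ hok
  · rw [hB]; simp [cst]
  · intro v hv
    rw [hB]
    simp [cst, (hadj v hv).ne']

lemma conf2 {D : ℕ} (hmin : ∀ H' < H, Chs H' D) (hnot : ¬ Chs H D) (hD : ∀ v, H.degree v ≤ D)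
    {u a b : V} (hab : a ≠ b) (hN : H.neighborFinset u = {a, b}) (ha : H.degree a = 2) :
    False := by
  have ua : H.Adj u a := mem_nb hN (by simp)
  have n1 := ua.ne
  have t1 := t_le hD ua ha
  have t2 := hD b
  apply hnot
  apply red' hmin u {a} {b} (by simp) (by simpa using hab) (by rw [hN]; rfl) (by simpa using ha)
    [a, u] (by simp [n1.symm]) (by ext; simp; tauto)
  simp [okL, cst, n1.symm]
  omega

lemma conf31 {D : ℕ} (hmin : ∀ H' < H, Chs H' D) (hnot : ¬ Chs H D) (hD : ∀ v, H.degree v ≤ D)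
    {u a b c : V} (hab : a ≠ b) (hac : a ≠ c) (hbc : b ≠ c)
    (hN : H.neighborFinset u = {a, b, c}) (ha : H.degree a = 2) :
    D + 1 ≤ H.degree b + H.degree c ∧
      (sdeg H a - H.degree u < D → D + 2 ≤ H.degree b + H.degree c) := by
  have ua : H.Adj u a := mem_nb hN (by simp)
  have n1 := ua.ne
  have t1 := t_le hD ua ha
  constructor
  · by_contra hcon
    apply hnot
    apply red' hmin u {a} {b, c} (by simp) (by simp [hab, hac]) (by rw [hN]; rfl)
      (by simpa using ha) [a, u] (by simp [n1.symm]) (by ext; simp; tauto)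
    simp [okL, cst, n1.symm, hbc]
    omega
  · intro hlt
    by_contra hcon
    apply hnot
    apply red' hmin u {a} {b, c} (by simp) (by simp [hab, hac]) (by rw [hN]; rfl)
      (by simpa using ha) [u, a] (by simp [n1]) (by ext; simp)
    simp [okL, cst, n1.symm, hbc]
    omega

lemma conf32a {D : ℕ} (hmin : ∀ H' < H, Chs H' D) (hnot : ¬ Chs H D)
    (hD : ∀ v, H.degree v ≤ D)
    {u a b c : V} (hab : a ≠ b) (hac : a ≠ c) (hbc : b ≠ c)
    (hN : H.neighborFinset u = {a, b, c}) (ha : H.degree a = 2) (hb : H.degree b = 2) :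
    D ≤ sdeg H b - H.degree u ∧ D ≤ H.degree c + 1 := by
  have ua : H.Adj u a := mem_nb hN (by simp)
  have ub : H.Adj u b := mem_nb hN (by simp)
  have n1 := ua.ne
  have n2 := ub.ne
  have t1 := t_le hD ua ha
  have t2 := t_le hD ub hb
  have t3 := hD c
  constructor
  · by_contra hcon
    apply hnot
    apply red' hmin u {a, b} {c} (by simp) (by simp [hac.symm, hbc.symm])
      (by rw [hN]; ext; simp) (by simp [ha, hb]) [u, a, b] (by simp [n1, n2, hab])
      (by ext; simp)
    simp [okL, cst, n1.symm, n2.symm, hab]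
    omega
  · by_contra hcon
    apply hnot
    apply red' hmin u {a, b} {c} (by simp) (by simp [hac.symm, hbc.symm])
      (by rw [hN]; ext; simp) (by simp [ha, hb]) [a, b, u]
      (by simp [n1.symm, n2.symm, hab]) (by ext; simp; tauto)
    simp [okL, cst, n1.symm, n2.symm, hab]
    omega

lemma conf33 {D : ℕ} (hD6 : 6 ≤ D) (hmin : ∀ H' < H, Chs H' D) (hnot : ¬ Chs H D)
    (hD : ∀ v, H.degree v ≤ D)
    {u a b c : V} (hab : a ≠ b) (hac : a ≠ c) (hbc : b ≠ c)
    (hN : H.neighborFinset u = {a, b, c}) (ha : H.degree a = 2) (hb : H.degree b = 2)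
    (hc : H.degree c = 2) : False := by
  have ua : H.Adj u a := mem_nb hN (by simp)
  have ub : H.Adj u b := mem_nb hN (by simp)
  have uc : H.Adj u c := mem_nb hN (by simp)
  have n1 := ua.ne
  have n2 := ub.ne
  have n3 := uc.ne
  have t1 := t_le hD ua ha
  have t2 := t_le hD ub hb
  have t3 := t_le hD uc hc
  have hcard : ({a, b, c} : Finset V).card = 3 := Finset.card_eq_three.2 ⟨a, b, c, hab, hac, hbc, rfl⟩
  apply hnot
  apply red' hmin u {a, b, c} ∅ (by simp) (by simp)
    (by rw [hN]; ext; simp) (by simp [ha, hb, hc]) [a, b, c, u]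
    (by simp [n1.symm, n2.symm, n3.symm, hab, hac, hbc]) (by ext; simp; tauto)
  simp [okL, cst, n1.symm, n2.symm, n3.symm, hcard]
  omega

lemma conf43 {D : ℕ} (hD6 : 6 ≤ D) (hmin : ∀ H' < H, Chs H' D) (hnot : ¬ Chs H D)
    {u a b c d : V} (hab : a ≠ b) (hac : a ≠ c) (had : a ≠ d) (hbc : b ≠ c) (hbd : b ≠ d)
    (hcd : c ≠ d)
    (hN : H.neighborFinset u = {a, b, c, d}) (ha : H.degree a = 2) (hb : H.degree b = 2)
    (hc : H.degree c = 2) (hd : H.degree d = 3) (ta : sdeg H a - H.degree u ≤ 5)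
    (tb : sdeg H b - H.degree u ≤ 5) (tc : sdeg H c - H.degree u ≤ 4) : False := by
  have ua : H.Adj u a := mem_nb hN (by simp)
  have ub : H.Adj u b := mem_nb hN (by simp)
  have uc : H.Adj u c := mem_nb hN (by simp)
  have n1 := ua.ne
  have n2 := ub.ne
  have n3 := uc.ne
  have hcard : ({a, b, c} : Finset V).card = 3 := Finset.card_eq_three.2 ⟨a, b, c, hab, hac, hbc, rfl⟩
  apply hnot
  apply red' hmin u {a, b, c} {d} (by simp) (by simp [had.symm, hbd.symm, hcd.symm])
    (by rw [hN]; ext; simp) (by simp [ha, hb, hc]) [u, a, b, c]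
    (by simp [n1, n2, n3, hab, hac, hbc]) (by ext; simp)
  simp [okL, cst, n1.symm, n2.symm, n3.symm, hcard, hd]
  omega

lemma conf44 {D : ℕ} (hD6 : 6 ≤ D) (hmin : ∀ H' < H, Chs H' D) (hnot : ¬ Chs H D)
    (hD : ∀ v, H.degree v ≤ D)
    {u a b c d : V} (hab : a ≠ b) (hac : a ≠ c) (had : a ≠ d) (hbc : b ≠ c) (hbd : b ≠ d)
    (hcd : c ≠ d)
    (hN : H.neighborFinset u = {a, b, c, d}) (ha : H.degree a = 2) (hb : H.degree b = 2)
    (hc : H.degree c = 2) (hd : H.degree d = 2) : D ≤ sdeg H d - H.degree u := by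
  have ua : H.Adj u a := mem_nb hN (by simp)
  have ub : H.Adj u b := mem_nb hN (by simp)
  have uc : H.Adj u c := mem_nb hN (by simp)
  have ud : H.Adj u d := mem_nb hN (by simp)
  have n1 := ua.ne
  have n2 := ub.ne
  have n3 := uc.ne
  have n4 := ud.ne
  have t1 := t_le hD ua ha
  have t2 := t_le hD ub hb
  have t3 := t_le hD uc hc
  have hcard : ({a, b, c, d} : Finset V).card = 4 := by
    simp [hab, hac, had, hbc, hbd, hcd]
  by_contra hcon
  apply hnot
  apply red' hmin u {a, b, c, d} ∅ (by simp) (by simp)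
    (by rw [hN]; ext; simp) (by simp [ha, hb, hc, hd]) [a, b, c, d, u]
    (by simp [n1.symm, n2.symm, n3.symm, n4.symm, hab, hac, had, hbc, hbd, hcd])
    (by ext; simp; tauto)
  simp [okL, cst, n1.symm, n2.symm, n3.symm, n4.symm, hcard]
  omega

/-- what a 2-vertex whose other neighbour has degree `t` needs -/
def need (t : ℕ) : ℚ := if 6 ≤ t then 4 / 3 else if t = 5 then 9 / 5 else 2

lemma need_le (t : ℕ) : need t ≤ 2 := by
  unfold need; split_ifs <;> norm_num

/-- charge sent from `u` to `v` -/
def sndc (H : SimpleGraph V) [DecidableRel H.Adj] (u v : V) : ℚ :=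
  if 6 ≤ H.degree u then 8 / 3 else if H.degree u = 5 then 11 / 5 else
  if 3 ≤ H.degree u then
    (if H.degree v = 2 then need (sdeg H v - H.degree u) else
      if H.degree u = 4 ∧ H.degree v = 3 then 1 / 2 else 0)
  else 0

lemma snd_nonneg (u v : V) : 0 ≤ sndc H u v := by
  unfold sndc need; split_ifs <;> norm_num

lemma snd_six {u v : V} (h : 6 ≤ H.degree u) : sndc H u v = 8 / 3 := by simp [sndc, h]

lemma snd_five {u v : V} (h : H.degree u = 5) : sndc H u v = 11 / 5 := by simp [sndc, h]

lemma snd_ge_five {u v : V} (h : 5 ≤ H.degree u) : 11 / 5 ≤ sndc H u v := by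
  rcases Nat.lt_or_ge (H.degree u) 6 with h1 | h1
  · rw [snd_five (by omega)]
  · rw [snd_six h1]; norm_num

lemma snd_two {u v : V} (h : H.degree u = 3 ∨ H.degree u = 4) (hv : H.degree v = 2) :
    sndc H u v = need (sdeg H v - H.degree u) := by
  rcases h with h | h <;> simp [sndc, h, hv]

lemma snd_from_two {u v : V} (h : H.degree u = 2) : sndc H u v = 0 := by simp [sndc, h]

lemma snd_three {u v : V} (h : H.degree u = 3) (hv : H.degree v ≠ 2) : sndc H u v = 0 := by
  simp [sndc, h, hv]

lemma snd_four {u v : V} (h : H.degree u = 4) (hv : 4 ≤ H.degree v) : sndc H u v = 0 := by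
  have h1 : H.degree v ≠ 2 := by omega
  have h2 : H.degree v ≠ 3 := by omega
  simp [sndc, h, h1, h2]

lemma snd_four_three {u v : V} (h : H.degree u = 4) (hv : H.degree v = 3) :
    sndc H u v = 1 / 2 := by
  simp [sndc, h, hv]

lemma snd_four_le {u v : V} (h : H.degree u = 4) (hv : 3 ≤ H.degree v) : sndc H u v ≤ 1 / 2 := by
  rcases hv.eq_or_lt with h1 | h1
  · rw [snd_four_three h h1.symm]
  · rw [snd_four h h1]; norm_num

lemma snd_four_le_two {u v : V} (h : H.degree u = 4) (hv : 2 ≤ H.degree v) : sndc H u v ≤ 2 := by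
  rcases hv.eq_or_lt with h1 | h1
  · rw [snd_two (Or.inr h) h1.symm]; exact need_le _
  · have := snd_four_le (H := H) h h1; linarith

lemma need_three {x y z : ℕ} (h1 : ¬ (x ≤ 5 ∧ y ≤ 5 ∧ z ≤ 4)) (h2 : ¬ (x ≤ 5 ∧ y ≤ 4 ∧ z ≤ 5))
    (h3 : ¬ (x ≤ 4 ∧ y ≤ 5 ∧ z ≤ 5)) : need x + need y + need z ≤ 11 / 2 := by
  unfold need
  split_ifs <;> first | (exfalso; omega) | norm_num

set_option maxHeartbeats 1000000 in
lemma final_charge {D : ℕ} (hD6 : 6 ≤ D) (hmin : ∀ H' < H, Chs H' D) (hnot : ¬ Chs H D)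
    (hD : ∀ v, H.degree v ≤ D) (hdeg : ∀ u v, H.Adj u v → 2 ≤ H.degree v)
    (u : V) (hu : 2 ≤ H.degree u) :
    0 ≤ 5 * (H.degree u : ℚ) - 14 + ∑ x ∈ H.neighborFinset u, (sndc H x u - sndc H u x) := by
  have hcardN : (H.neighborFinset u).card = H.degree u := H.card_neighborFinset_eq_degree u
  rcases Nat.lt_or_ge (H.degree u) 5 with h5 | h5
  swap
  · -- large vertices
    have key : ∀ q : ℚ, (∀ x, sndc H u x = q) →
        -(H.degree u * q) ≤ ∑ x ∈ H.neighborFinset u, (sndc H x u - sndc H u x) := by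
      intro q hq
      calc -(H.degree u * q) = ∑ x ∈ H.neighborFinset u, (-q) := by
            rw [Finset.sum_const, hcardN]; simp
        _ ≤ _ := by
            apply Finset.sum_le_sum
            intro x _
            rw [hq]
            linarith [snd_nonneg (H := H) x u]
    rcases h5.eq_or_lt with h6 | h6
    · have := key _ (fun x => snd_five h6.symm)
      rw [← h6] at this ⊢
      push_cast at this ⊢
      linarith
    · have := key _ (fun x => snd_six h6)
      have h7 : (6 : ℚ) ≤ H.degree u := by exact_mod_cast h6
      linarith
  interval_cases hdu : H.degree u
  · -- degree 2
    obtain ⟨a, b, hab, hN⟩ := Finset.card_eq_two.1 hcardN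
    have ua : H.Adj u a := mem_nb hN (by simp)
    have ub : H.Adj u b := mem_nb hN (by simp)
    have ha : 3 ≤ H.degree a := by
      by_contra hcon
      exact conf2 hmin hnot hD hab hN (by have := hdeg _ _ ua; omega)
    have hb : 3 ≤ H.degree b := by
      by_contra hcon
      exact conf2 hmin hnot hD hab.symm (by rw [hN, Finset.pair_comm])
        (by have := hdeg _ _ ub; omega)
    have hs : sdeg H u = H.degree a + H.degree b := by
      rw [sdeg, hN, Finset.sum_pair hab]
    have e1 : sdeg H u - H.degree a = H.degree b := by omega
    have e2 : sdeg H u - H.degree b = H.degree a := by omega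
    rw [hN, Finset.sum_pair hab, snd_from_two hdu, snd_from_two hdu]
    have key : 4 ≤ sndc H a u + sndc H b u := by
      simp only [sndc, hdu, e1, e2, ha, hb, if_true, need]
      split_ifs <;> first | omega | norm_num
    push_cast
    linarith
  · -- degree 3
    obtain ⟨a, b, c, hab, hac, hbc, hN, q1, q2⟩ := sorted_three (fun x => H.degree x) _ hcardN
    have ua : H.Adj u a := mem_nb hN (by simp)
    have ub : H.Adj u b := mem_nb hN (by simp)
    have uc : H.Adj u c := mem_nb hN (by simp)
    have ha := hdeg _ _ ua
    have na := snd_nonneg (H := H) a u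
    have nb := snd_nonneg (H := H) b u
    have nc := snd_nonneg (H := H) c u
    have hsum : ∑ x ∈ H.neighborFinset u, (sndc H x u - sndc H u x) =
        (sndc H a u - sndc H u a) + ((sndc H b u - sndc H u b) + (sndc H c u - sndc H u c)) := by
      rw [hN, Finset.sum_insert (by simp [hab, hac]), Finset.sum_pair hbc]
    rw [hsum]
    push_cast
    rcases Nat.lt_or_ge 2 (H.degree a) with ha2 | ha2
    · rw [snd_three hdu (v := a) (by omega), snd_three hdu (v := b) (by omega),
        snd_three hdu (v := c) (by omega)]
      linarith
    have ha2' : H.degree a = 2 := by omega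
    rcases Nat.lt_or_ge 2 (H.degree b) with hb2 | hb2
    · -- one 2-neighbour
      rw [snd_two (Or.inl hdu) ha2', snd_three hdu (v := b) (by omega),
        snd_three hdu (v := c) (by omega), snd_from_two ha2']
      obtain ⟨k1, k2⟩ := conf31 hmin hnot hD hab hac hbc hN ha2'
      rcases Nat.lt_or_ge (H.degree c) 5 with hc5 | hc5
      · have hc4 : H.degree c = 4 := by omega
        rw [snd_four_three hc4 hdu]
        by_cases h6 : 6 ≤ sdeg H a - H.degree u
        · have : need (sdeg H a - H.degree u) = 4 / 3 := by simp [need, h6]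
          rw [this]
          linarith
        · have := k2 (by omega)
          have hb4 : H.degree b = 4 := by omega
          rw [snd_four_three hb4 hdu]
          have := need_le (sdeg H a - H.degree u)
          linarith
      · have := snd_ge_five (H := H) (v := u) hc5
        have := need_le (sdeg H a - H.degree u)
        linarith
    have hb2' : H.degree b = 2 := by omega
    rcases Nat.lt_or_ge 2 (H.degree c) with hc2 | hc2
    · obtain ⟨k1, k2⟩ := conf32a hmin hnot hD hab hac hbc hN ha2' hb2'
      obtain ⟨k3, -⟩ := conf32a hmin hnot hD hab.symm hbc hac
        (by rw [hN]; clear * -; ext; simp; tauto) hb2' ha2'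
      have n1 : need (sdeg H a - H.degree u) = 4 / 3 := by
        rw [need, if_pos (by omega)]
      have n2 : need (sdeg H b - H.degree u) = 4 / 3 := by
        rw [need, if_pos (by omega)]
      rw [snd_two (Or.inl hdu) ha2', snd_two (Or.inl hdu) hb2', n1, n2,
        snd_three hdu (v := c) (by omega)]
      have := snd_ge_five (H := H) (u := c) (v := u) (by omega)
      linarith
    · exact (conf33 hD6 hmin hnot hD hab hac hbc hN ha2' hb2' (by omega)).elim
  · -- degree 4
    obtain ⟨a, b, c, d, hab, hac, had, hbc, hbd, hcd, hN, q1, q2, q3⟩ :=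
      sorted_four (fun x => H.degree x) _ hcardN
    have ua : H.Adj u a := mem_nb hN (by simp)
    have ub : H.Adj u b := mem_nb hN (by simp)
    have uc : H.Adj u c := mem_nb hN (by simp)
    have ud : H.Adj u d := mem_nb hN (by simp)
    have ha := hdeg _ _ ua
    have na := snd_nonneg (H := H) a u
    have nb := snd_nonneg (H := H) b u
    have nc := snd_nonneg (H := H) c u
    have nd := snd_nonneg (H := H) d u
    have hsum : ∑ x ∈ H.neighborFinset u, (sndc H x u - sndc H u x) =
        (sndc H a u - sndc H u a) + ((sndc H b u - sndc H u b) +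
          ((sndc H c u - sndc H u c) + (sndc H d u - sndc H u d))) := by
      rw [hN, Finset.sum_insert (by simp [hab, hac, had]),
        Finset.sum_insert (by simp [hbc, hbd]), Finset.sum_pair hcd]
    rw [hsum]
    push_cast
    have la := snd_four_le_two (H := H) (v := a) hdu ha
    have lb := snd_four_le_two (H := H) (v := b) hdu (by omega)
    have lc := snd_four_le_two (H := H) (v := c) hdu (by omega)
    rcases Nat.lt_or_ge 2 (H.degree c) with hc2 | hc2
    · have := snd_four_le (H := H) (v := c) hdu hc2
      have := snd_four_le (H := H) (v := d) hdu (by omega)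
      linarith
    have ha2 : H.degree a = 2 := by omega
    have hb2 : H.degree b = 2 := by omega
    have hc2 : H.degree c = 2 := by omega
    rcases Nat.lt_or_ge 3 (H.degree d) with hd4 | hd4
    · have := snd_four (H := H) (v := d) hdu hd4
      linarith
    rcases Nat.lt_or_ge 2 (H.degree d) with hd3 | hd2
    · have hd3 : H.degree d = 3 := by omega
      have k1 := conf43 hD6 hmin hnot hab hac had hbc hbd hcd hN ha2 hb2 hc2 hd3
      have k2 := conf43 hD6 hmin hnot hac hab had hbc.symm hcd hbd
        (by rw [hN]; clear * -; ext; simp; tauto) ha2 hc2 hb2 hd3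
      have k3 := conf43 hD6 hmin hnot hbc hab.symm hbd hac.symm hcd had
        (by rw [hN]; clear * -; ext; simp; tauto) hb2 hc2 ha2 hd3
      rw [snd_four_three hdu hd3, snd_two (Or.inr hdu) ha2, snd_two (Or.inr hdu) hb2,
        snd_two (Or.inr hdu) hc2]
      have : need (sdeg H a - H.degree u) + need (sdeg H b - H.degree u)
          + need (sdeg H c - H.degree u) ≤ 11 / 2 := by
        exact need_three (fun q => k1 q.1 q.2.1 q.2.2) (fun q => k2 q.1 q.2.2 q.2.1)
          (fun q => k3 q.2.1 q.2.2 q.1)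
      linarith
    · have hd2 : H.degree d = 2 := by omega
      have k1 := conf44 hD6 hmin hnot hD hab hac had hbc hbd hcd hN ha2 hb2 hc2 hd2
      have k2 := conf44 hD6 hmin hnot hD hab had hac hbd hbc hcd.symm
        (by rw [hN]; clear * -; ext; simp; tauto) ha2 hb2 hd2 hc2
      have k3 := conf44 hD6 hmin hnot hD had hac hab hcd.symm hbd.symm hbc.symm
        (by rw [hN]; clear * -; ext; simp; tauto) ha2 hd2 hc2 hb2
      have k4 := conf44 hD6 hmin hnot hD hbd.symm hcd.symm had.symm hbc hab.symm hac.symm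
        (by rw [hN]; clear * -; ext; simp; tauto) hd2 hb2 hc2 ha2
      have n1 : need (sdeg H a - H.degree u) = 4 / 3 := by rw [need, if_pos (by omega)]
      have n2 : need (sdeg H b - H.degree u) = 4 / 3 := by rw [need, if_pos (by omega)]
      have n3 : need (sdeg H c - H.degree u) = 4 / 3 := by rw [need, if_pos (by omega)]
      have n4 : need (sdeg H d - H.degree u) = 4 / 3 := by rw [need, if_pos (by omega)]
      rw [snd_two (Or.inr hdu) ha2, snd_two (Or.inr hdu) hb2,
        snd_two (Or.inr hdu) hc2, snd_two (Or.inr hdu) hd2, n1, n2, n3, n4]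
      linarith

end Config


/-! ### Main argument -/

section Main

variable {V : Type} [Fintype V] [DecidableEq V]

lemma no_minimal (H : SimpleGraph V) [DecidableRel H.Adj] {X Y : V → ℝ} (h : Drawn H X Y)
    (hg : 7 ≤ H.egirth) {D : ℕ} (hD6 : 6 ≤ D) (hmin : ∀ H' < H, Chs H' D)
    (hD : ∀ v, H.degree v ≤ D) : Chs H D := by
  by_contra hnot
  by_cases hne : ∃ v u, H.Adj v u
  swap
  · push Not at hne
    apply hnot
    intro L hL
    have : ∀ v, ∃ c, c ∈ L v := fun v =>
      Finset.card_pos.1 (by have := hL v; omega)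
    choose φ hφ using this
    refine ⟨φ, hφ, ?_⟩
    rintro u v ⟨-, h1 | ⟨w, h1, -⟩⟩
    · exact absurd h1 (hne _ _)
    · exact absurd h1 (hne _ _)
  have hdeg : ∀ u v, H.Adj u v → 2 ≤ H.degree v := by
    intro u v huv
    have h1 : 0 < H.degree v := (H.degree_pos_iff_exists_adj v).2 ⟨u, huv.symm⟩
    have h2 : H.degree v ≠ 1 := fun h2 => hnot (red_leaf hmin hD h2)
    omega
  have hdeg' : ∀ v u, H.Adj v u → ∃ w, w ≠ u ∧ H.Adj v w := by
    intro v u hvu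
    have h1 := hdeg _ _ hvu.symm
    rw [← H.card_neighborFinset_eq_degree] at h1
    obtain ⟨w, hw, hwu⟩ := Finset.exists_mem_ne (by omega : 1 < (H.neighborFinset v).card) u
    exact ⟨w, hwu, by simpa using hw⟩
  have key := euler_bound h hg hdeg' hne
  have hcard := card_orE H h.inj
  set N : Finset V := Finset.univ.filter (fun v => 0 < H.degree v) with hNdef
  have hN : Fintype.card {v : V // ∃ u, H.Adj v u} = N.card := by
    rw [Fintype.card_subtype]
    congr 1
    ext v
    simp [hNdef, H.degree_pos_iff_exists_adj]
  have key2 : 5 * (orE H X).card < 7 * N.card := by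
    rw [← hN]
    convert key
  have hsumN : ∑ v ∈ N, H.degree v = ∑ v, H.degree v := by
    apply Finset.sum_subset (Finset.subset_univ _)
    intro v _ hv
    simpa [hNdef] using hv
  have hpos : ∀ u ∈ N, 0 ≤ 5 * (H.degree u : ℚ) - 14 +
      ∑ x ∈ H.neighborFinset u, (sndc H x u - sndc H u x) := by
    intro u hu
    have hu0 : 0 < H.degree u := by simpa [hNdef] using hu
    obtain ⟨x, hx⟩ := (H.degree_pos_iff_exists_adj u).1 hu0
    exact final_charge hD6 hmin hnot hD hdeg u (hdeg _ _ hx.symm)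
  have htot := Finset.sum_nonneg hpos
  rw [Finset.sum_add_distrib] at htot
  have hz : ∑ u ∈ N, ∑ x ∈ H.neighborFinset u, (sndc H x u - sndc H u x) = 0 := by
    have e1 : ∑ u ∈ N, ∑ x ∈ H.neighborFinset u, (sndc H x u - sndc H u x) =
        ∑ u, ∑ x ∈ H.neighborFinset u, (sndc H x u - sndc H u x) := by
      apply Finset.sum_subset (Finset.subset_univ _)
      intro v _ hv
      have h0 : H.degree v = 0 := by simpa [hNdef] using hv
      rw [← H.card_neighborFinset_eq_degree, Finset.card_eq_zero] at h0
      rw [h0]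
      simp
    have e2 : ∀ u, ∑ x ∈ H.neighborFinset u, (sndc H x u - sndc H u x) =
        ∑ x, ((if H.Adj x u then sndc H x u else 0) - (if H.Adj u x then sndc H u x else 0)) := by
      intro u
      rw [SimpleGraph.neighborFinset_eq_filter, Finset.sum_filter]
      apply Finset.sum_congr rfl
      intro x _
      by_cases hx : H.Adj u x
      · simp [hx, hx.symm]
      · have : ¬ H.Adj x u := fun q => hx q.symm
        simp [hx, this]
    rw [e1]
    simp_rw [e2, Finset.sum_sub_distrib]
    rw [Finset.sum_comm, sub_self]
  have hs : ∑ u ∈ N, (5 * (H.degree u : ℚ) - 14) =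
      10 * ((orE H X).card : ℚ) - 14 * (N.card : ℚ) := by
    rw [Finset.sum_sub_distrib, ← Finset.mul_sum, ← Nat.cast_sum, hsumN, hcard]
    simp
    ring
  rw [hz, hs] at htot
  have key3 : 5 * ((orE H X).card : ℚ) < 7 * (N.card : ℚ) := by exact_mod_cast key2
  linarith

lemma all_sub (G : SimpleGraph V) [DecidableRel G.Adj] {X Y : V → ℝ} (h : Drawn G X Y)
    (hg : 7 ≤ G.egirth) (hΔ : 6 ≤ G.maxDegree) (H : SimpleGraph V) :
    H ≤ G → Chs H G.maxDegree := by
  classical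
  induction H using WellFoundedLT.induction with
  | ind H ih =>
    intro hle
    refine no_minimal H (h.mono hle) (hg.trans (SimpleGraph.egirth_anti hle)) hΔ
      (fun H' hlt => ih H' hlt (hlt.le.trans hle)) ?_
    intro v
    exact (SimpleGraph.degree_le_of_le hle).trans (G.degree_le_maxDegree v)

end Main

/-- If `G` is planar with girth at least 7 (acyclic graphs have `egirth = ⊤`) and
`Δ ≥ 6`, then `χ²ₗ(G) ≤ Δ + 3`. -/
theorem twoDist_choosable_of_planar_girth_seven
    {V : Type} [Fintype V] [DecidableEq V] (G : SimpleGraph V) [DecidableRel G.Adj]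
    (hplanar : IsPlanar G) (hg : 7 ≤ G.egirth) (hΔ : 6 ≤ G.maxDegree) :
    ∀ L : V → Finset ℕ, (∀ v, G.maxDegree + 3 ≤ (L v).card) →
      ∃ φ : V → ℕ, IsTwoDistListColoring G L φ := by
  obtain ⟨X, Y, h⟩ := exists_drawn G hplanar
  exact all_sub G h hg hΔ G le_rfl
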